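/- For every closed surface S there exists a natural number N (in the paper N = 4g + 3 where g is the genus of S) with the following property: for all points d₁, d₃ ∈ S, every closed disk D₂ ⊆ S, and every cat's cradle A₁, …, A_N between d₁ and d₃ through D₂, no connected component of D₂ \ (A₁ ∪ ⋯ ∪ A_N) has closure meeting every one of the arcs A₁, …, A_N. -/

import Mathlib

open Set Metric Filter Topology

/-- A space is locally homeomorphic to ℝ²: every point has an open
neighborhood homeomorphic to the Euclidean plane. -/
def LocallyEuclidean2 (S : Type*) [TopologicalSpace S] : Prop :=
  ∀ x : S, ∃ U : Set S, IsOpen U ∧ x ∈ U ∧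
    Nonempty (U ≃ₜ EuclideanSpace ℝ (Fin 2))

section Defs

variable {S : Type*} [TopologicalSpace S]

/-- A continuum: a nonempty compact connected subset. -/
def IsContinuum (X : Set S) : Prop := IsCompact X ∧ IsConnected X

/-- A complementary domain of `X`: a connected component of the complement of `X`. -/
def IsComplementaryDomain (X U : Set S) : Prop :=
  ∃ x, x ∉ X ∧ U = connectedComponentIn Xᶜ x

/-- A proper subcontinuum of `X`. -/
def IsProperSubcontinuum (X A : Set S) : Prop :=
  A.Nonempty ∧ IsClosed A ∧ IsConnected A ∧ A ⊆ X ∧ A ≠ X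

/-- `X` is decomposable: the union of two proper subcontinua. -/
def IsDecomposable (X : Set S) : Prop :=
  ∃ A B, IsProperSubcontinuum X A ∧ IsProperSubcontinuum X B ∧ A ∪ B = X

/-- `X` is the essential union of three proper subcontinua. -/
def IsEssentialUnionOfThree (X : Set S) : Prop :=
  ∃ X₁ X₂ X₃, IsProperSubcontinuum X X₁ ∧ IsProperSubcontinuum X X₂ ∧
    IsProperSubcontinuum X X₃ ∧ X₁ ∪ X₂ ∪ X₃ = X ∧
    ¬ X₁ ⊆ X₂ ∪ X₃ ∧ ¬ X₂ ⊆ X₁ ∪ X₃ ∧ ¬ X₃ ⊆ X₁ ∪ X₂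

/-- `X` is 2-indecomposable: decomposable but not the essential union of
three proper subcontinua. -/
def Is2Indecomposable (X : Set S) : Prop :=
  IsDecomposable X ∧ ¬ IsEssentialUnionOfThree X

/-- `X` is shielded: no complementary domain has frontier equal to `X`. -/
def IsShielded (X : Set S) : Prop :=
  ∀ U, IsComplementaryDomain X U → frontier U ≠ X

/-- A generalized crosscut of `U`. -/
def IsGenCrosscut (U A : Set S) : Prop :=
  A ⊆ U ∧ Nonempty (A ≃ₜ Set.Ioo (0:ℝ) 1) ∧ closure A \ A ⊆ frontier U

/-- `T` is a shadow of the (generalized) crosscut `A` of `U`. -/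
def IsShadowOf (U A T : Set S) : Prop :=
  ∃ x ∈ U \ A, T = closure (connectedComponentIn (U \ A) x) ∩ frontier U

/-- An arc with endpoints `a` and `b`. -/
def IsArcFrom (A : Set S) (a b : S) : Prop :=
  ∃ f : Set.Icc (0:ℝ) 1 → S, Continuous f ∧ Function.Injective f ∧
    Set.range f = A ∧ f ⟨0, by norm_num⟩ = a ∧ f ⟨1, by norm_num⟩ = b

/-- A crosscut of `U`: a copy of `(0,1)` in `U` whose closure is an arc
meeting the frontier of `U` exactly at the endpoints of the arc. -/
def IsCrosscut (U K : Set S) : Prop :=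
  K ⊆ U ∧ Nonempty (K ≃ₜ Set.Ioo (0:ℝ) 1) ∧
    ∃ a b, IsArcFrom (closure K) a b ∧ closure K ∩ frontier U = {a, b}

/-- A closed disk: a set homeomorphic to the closed unit disk in ℝ². -/
def IsClosedDisk (D : Set S) : Prop :=
  Nonempty (D ≃ₜ Metric.closedBall (0 : EuclideanSpace ℝ (Fin 2)) 1)

/-- A cat's cradle between `d₁` and `d₃`: a family of arcs from `d₁` to `d₃`
whose interiors are pairwise disjoint. -/
def IsCatsCradle {ι : Type*} (d₁ d₃ : S) (A : ι → Set S) : Prop :=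
  (∀ i, IsArcFrom (A i) d₁ d₃) ∧
    Pairwise fun i j => (A i \ {d₁, d₃}) ∩ (A j \ {d₁, d₃}) = ∅

/-- A cat's cradle between `d₁` and `d₃` through `D₂`. -/
def IsCatsCradleThrough {ι : Type*} (d₁ d₃ : S) (D₂ : Set S) (A : ι → Set S) : Prop :=
  IsCatsCradle d₁ d₃ A ∧ D₂ ∩ {d₁, d₃} = ∅ ∧ ∀ i, (A i ∩ D₂).Nonempty

/-- A chord of the closed disk `D`: an arc in `D` meeting the frontier of `D`
exactly at its two endpoints. -/
def IsChord (D A : Set S) : Prop :=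
  ∃ a b, IsArcFrom A a b ∧ A ⊆ D ∧ A ∩ frontier D = {a, b}

/-- A sequence of pairwise disjoint chords of `D` is linearly ordered if each
middle chord separates the earlier ones from the later ones in `D`. -/
def LinearlyOrderedChords (D : Set S) (A : ℕ → Set S) : Prop :=
  (Pairwise fun i j => Disjoint (A i) (A j)) ∧
    ∀ i j k, i < j → j < k → ∀ x ∈ A i, ∀ y ∈ A k,
      connectedComponentIn (D \ A j) x ≠ connectedComponentIn (D \ A j) y

end Defs

section MetricDefs

variable {S : Type*} [MetricSpace S]

/-- Convergence of a sequence of sets to `X` in the Hausdorff metric. -/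
def HausdorffConvergesTo (A : ℕ → Set S) (X : Set S) : Prop :=
  Tendsto (fun n => hausdorffDist (A n) X) atTop (𝓝 0)

/-- The double-pass condition for a sequence of domains. -/
def DoublePassCondition (X : Set S) (U : ℕ → Set S) : Prop :=
  ∀ K : ℕ → Set S, (∀ n, IsGenCrosscut (U n) (K n)) →
    ∃ Sh : ℕ → Set S, (∀ n, IsShadowOf (U n) (K n) (Sh n)) ∧ HausdorffConvergesTo Sh X

/-- The double-pass condition with (genuine) crosscuts. -/
def DoublePassConditionCrosscuts (X : Set S) (U : ℕ → Set S) : Prop :=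
  ∀ K : ℕ → Set S, (∀ n, IsCrosscut (U n) (K n)) →
    ∃ Sh : ℕ → Set S, (∀ n, IsShadowOf (U n) (K n) (Sh n)) ∧ HausdorffConvergesTo Sh X

end MetricDefs


namespace CC

/-- homotopy lifting for the exponential -/
lemma homotopy_log {X : Type*} [TopologicalSpace X] (H : unitInterval × X → ℂ)
    (hc : Continuous H) (h0 : ∀ p, H p ≠ 0) (h1 : ∀ x, H (0, x) = 1) :
    ∃ l : X → ℂ, Continuous l ∧ ∀ x, Complex.exp (l x) = H (1, x) := by
  let H' : C(unitInterval × X, {z : ℂ // z ≠ 0}) :=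
    ⟨fun p => ⟨H p, h0 p⟩, by fun_prop⟩
  have hH0 : ∀ x : X, H' (0, x) = (fun z : ℂ ↦ (⟨_, z.exp_ne_zero⟩ : {z : ℂ // z ≠ 0}))
      ((ContinuousMap.const X (0:ℂ)) x) := by
    intro x
    apply Subtype.ext
    simp [H', h1]
  let L := Complex.isCoveringMap_exp.liftHomotopy H' (ContinuousMap.const X (0:ℂ)) hH0
  refine ⟨fun x => L (1, x), by fun_prop, fun x => ?_⟩
  have := congrFun (Complex.isCoveringMap_exp.liftHomotopy_lifts H'
    (ContinuousMap.const X (0:ℂ)) hH0) (1, x)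
  exact congrArg Subtype.val this

lemma entire_log (F : ℂ → ℂ) (hc : Continuous F) (h0 : ∀ z, F z ≠ 0) :
    ∃ l : ℂ → ℂ, Continuous l ∧ ∀ z, Complex.exp (l z) = F z := by
  obtain ⟨l, hl, hl'⟩ := homotopy_log (X := ℂ) (fun p => F ((p.1 : ℝ) * p.2) / F 0)
    (by fun_prop) (fun p => div_ne_zero (h0 _) (h0 _)) (by intro x; simp [h0])
  obtain ⟨c, hc⟩ : ∃ c, Complex.exp c = F 0 := ⟨Complex.log (F 0), Complex.exp_log (h0 0)⟩
  refine ⟨fun z => l z + c, by fun_prop, fun z => ?_⟩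
  rw [Complex.exp_add, hl', hc]
  simp [h0]

/-- two continuous logs on a preconnected space differ by a constant -/
lemma sign_const {X : Type*} [TopologicalSpace X] {B : Set X} (hB : IsPreconnected B)
    (f g : X → ℂ) (hf : ContinuousOn f B) (hg : ContinuousOn g B) (h : ∀ x ∈ B, f x ^ 2 = g x ^ 2)
    (h0 : ∀ x ∈ B, g x ≠ 0) : (∀ x ∈ B, f x = g x) ∨ (∀ x ∈ B, f x = - g x) := by
  have := hB.eq_or_eq_neg_of_sq_eq hf hg (fun x hx => by simpa using h x hx) (fun hx => h0 _ hx)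
  rcases this with h | h
  · left; exact h
  · right; exact h

lemma no_sqrt_sphere (q : ℂ) (R : ℝ) (hR : 0 < R) (w : ℂ → ℂ) (hw : ContinuousOn w (sphere q R))
    (h : ∀ z ∈ sphere q R, w z ^ 2 = z - q) : False := by
  let c : ℝ → ℂ := fun θ => q + R * Complex.exp (θ * Complex.I)
  have hcs : ∀ θ, c θ ∈ sphere q R := by
    intro θ
    simp [c, Complex.norm_exp_ofReal_mul_I, abs_of_pos hR]
  have hcc : Continuous c := by fun_prop
  have h1 : ContinuousOn (fun θ : ℝ => w (c θ)) univ :=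
    hw.comp hcc.continuousOn (fun θ _ => hcs θ)
  let s : ℝ → ℂ := fun θ => (Real.sqrt R : ℂ) * Complex.exp (θ / 2 * Complex.I)
  have hsq : ((Real.sqrt R : ℂ))^2 = R := by
    norm_cast; exact Real.sq_sqrt hR.le
  have hs0 : ∀ θ, s θ ≠ 0 := by
    intro θ
    refine mul_ne_zero ?_ (Complex.exp_ne_zero _)
    norm_cast
    exact (Real.sqrt_pos.2 hR).ne'
  have hper : c (2 * Real.pi) = c 0 := by
    simp [c, Complex.exp_two_pi_mul_I]
  have hs1 : s (2 * Real.pi) = - s 0 := by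
    simp only [s]
    have : ((2 * Real.pi : ℝ) : ℂ) / 2 * Complex.I = Real.pi * Complex.I := by push_cast; ring
    rw [this, Complex.exp_pi_mul_I]; simp
  have key := sign_const (isPreconnected_univ (α := ℝ)) (fun θ => w (c θ)) s h1
    (by fun_prop) (fun θ _ => by
      simp only [s]
      rw [h _ (hcs θ), mul_pow, hsq, ← Complex.exp_nat_mul]
      simp only [c]
      have : ((2:ℕ):ℂ) * (θ / 2 * Complex.I) = θ * Complex.I := by push_cast; ring
      rw [this]; ring) (fun θ _ => hs0 θ)
  rcases key with h | h
  · have a := h 0 trivial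
    have b := h (2 * Real.pi) trivial
    rw [hper, a, hs1] at b
    exact hs0 0 (self_eq_neg.1 b)
  · have a := h 0 trivial
    have b := h (2 * Real.pi) trivial
    rw [hper, a, hs1] at b
    have := hs0 0
    rw [neg_neg] at b
    exact this (neg_eq_self.1 b)

lemma punctured (q : ℂ) (g : ℂ → ℂ) (hg : ContinuousOn g {q}ᶜ) (h0 : ∀ z ∈ ({q}ᶜ : Set ℂ), g z ≠ 0) :
    ∃ (n : ℤ) (l : ℂ → ℂ), ContinuousOn l {q}ᶜ ∧
      ∀ z ∈ ({q}ᶜ : Set ℂ), g z = (z - q) ^ n * Complex.exp (l z) := by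
  have hmem : ∀ ζ : ℂ, q + Complex.exp ζ ∈ ({q}ᶜ : Set ℂ) := by
    intro ζ; simp [Complex.exp_ne_zero]
  have hc : Continuous fun ζ : ℂ => g (q + Complex.exp ζ) := by
    rw [← continuousOn_univ]
    exact hg.comp (by fun_prop) (fun ζ _ => hmem ζ)
  obtain ⟨L, hL, hL'⟩ := entire_log _ hc (fun ζ => h0 _ (hmem ζ))
  -- period
  have hper : ∀ ζ, ∃ n : ℤ, L (ζ + 2 * Real.pi * Complex.I) = L ζ + n * (2 * Real.pi * Complex.I) := by
    intro ζ
    have : Complex.exp (L (ζ + 2 * Real.pi * Complex.I)) = Complex.exp (L ζ) := by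
      rw [hL', hL', Complex.exp_add, Complex.exp_two_pi_mul_I, mul_one]
    exact Complex.exp_eq_exp_iff_exists_int.1 this
  choose n hn using hper
  have hpi : (2 * Real.pi * Complex.I : ℂ) ≠ 0 := Complex.two_pi_I_ne_zero
  have hnc : Continuous n := by
    have h1 : Continuous fun ζ => ((n ζ : ℂ)) := by
      have : (fun ζ => ((n ζ : ℂ))) = fun ζ =>
          (L (ζ + 2 * Real.pi * Complex.I) - L ζ) / (2 * Real.pi * Complex.I) := by
        funext ζ
        rw [hn, add_sub_cancel_left, mul_div_cancel_right₀ _ hpi]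
      rw [this]; fun_prop
    have h2 : Continuous fun ζ => ((n ζ : ℝ)) := by
      have := Complex.continuous_re.comp h1
      simpa [Function.comp_def] using this
    exact (Int.isClosedEmbedding_coe_real).isInducing.continuous_iff.2 h2
  have hnconst : ∀ ζ, n ζ = n 0 := fun ζ =>
    PreconnectedSpace.constant inferInstance hnc
  set N := n 0 with hN
  let M : ℂ → ℂ := fun ζ => L ζ - N * ζ
  have hM : Continuous M := by fun_prop
  have hMper : ∀ ζ, M (ζ + 2 * Real.pi * Complex.I) = M ζ := by
    intro ζ
    simp only [M]; rw [hn, hnconst]; ring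
  have hMper2 : Function.Periodic M (2 * Real.pi * Complex.I) := hMper
  have hMeq : ∀ a b, Complex.exp a = Complex.exp b → M a = M b := by
    intro a b hab
    obtain ⟨k, hk⟩ := Complex.exp_eq_exp_iff_exists_int.1 hab
    rw [hk]
    exact hMper2.int_mul k b
  refine ⟨N, fun z => M (Complex.log (z - q)), ?_, ?_⟩
  · intro z hz
    have hz' : z - q ≠ 0 := sub_ne_zero.2 hz
    apply ContinuousAt.continuousWithinAt
    -- local branch
    set a := Complex.log (z - q) with ha
    have hloc : (fun y => M (Complex.log (y - q))) =ᶠ[𝓝 z]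
        fun y => M (a + Complex.log ((y - q) / (z - q))) := by
      have : ∀ᶠ y in 𝓝 z, y ≠ q := isOpen_ne.mem_nhds hz
      filter_upwards [this] with y hy
      have hy' : y - q ≠ 0 := sub_ne_zero.2 hy
      apply hMeq
      rw [Complex.exp_log hy', Complex.exp_add, ha, Complex.exp_log hz',
        Complex.exp_log (div_ne_zero hy' hz')]
      field_simp
    refine ContinuousAt.congr ?_ hloc.symm
    have : ContinuousAt (fun y => Complex.log ((y - q) / (z - q))) z := by
      apply ContinuousAt.clog
      · fun_prop (disch := exact hz')
      · rw [div_self hz']; exact Complex.one_mem_slitPlane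
    exact hM.continuousAt.comp (continuousAt_const.add this)
  · intro z hz
    have hz' : z - q ≠ 0 := sub_ne_zero.2 hz
    have h1 := hL' (Complex.log (z - q))
    rw [Complex.exp_log hz', add_sub_cancel] at h1
    rw [← h1]
    simp only [M]
    conv_rhs => rw [← Complex.exp_log hz', ← Complex.exp_int_mul, ← Complex.exp_add,
      Complex.exp_log hz']
    congr 1; ring

lemma punctured2 (p q : ℂ) (hpq : p ≠ q) (g : ℂ → ℂ) (hg : ContinuousOn g {p, q}ᶜ)
    (h0 : ∀ z ∈ ({p, q}ᶜ : Set ℂ), g z ≠ 0) :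
    ∃ (n m : ℤ) (l : ℂ → ℂ), ContinuousOn l {p, q}ᶜ ∧
      ∀ z ∈ ({p, q}ᶜ : Set ℂ), g z = (z - p) ^ n * (z - q) ^ m * Complex.exp (l z) := by
  -- radial projection to a small disc around p
  set r : ℝ := dist p q / 2 with hr
  have hr0 : 0 < r := by have := dist_pos.2 hpq; positivity
  let pr : ℂ → ℂ := fun z => p + (z - p) * ((min 1 (r / ‖z - p‖) : ℝ) : ℂ)
  have hprc : ContinuousOn pr {p}ᶜ := by
    intro z hz
    have hz' : ‖z - p‖ ≠ 0 := by simpa [sub_eq_zero] using hz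
    apply ContinuousAt.continuousWithinAt
    simp only [pr]
    fun_prop (disch := assumption)
  have hprm : ∀ z ∈ ({p}ᶜ : Set ℂ), pr z ∈ ({p, q}ᶜ : Set ℂ) := by
    intro z hz
    have hz' : 0 < ‖z - p‖ := by simpa [sub_eq_zero] using hz
    have hpos : 0 < min 1 (r / ‖z - p‖) := by positivity
    have hnorm : dist (pr z) p ≤ r := by
      simp only [pr, dist_eq_norm, add_sub_cancel_left, norm_mul, Complex.norm_real, Real.norm_eq_abs,
        abs_of_pos hpos]
      calc ‖z - p‖ * min 1 (r / ‖z - p‖) ≤ ‖z - p‖ * (r / ‖z - p‖) := by gcongr; exact min_le_right _ _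
        _ = r := by field_simp
    simp only [mem_compl_iff, mem_insert_iff, mem_singleton_iff, not_or]
    constructor
    · simp only [pr]
      intro h
      have : (z - p) * ((min 1 (r / ‖z - p‖) : ℝ) : ℂ) = 0 := by linear_combination h
      rcases mul_eq_zero.1 this with h | h
      · exact hz (sub_eq_zero.1 h)
      · exact hpos.ne' (by exact_mod_cast h)
    · intro h
      rw [h, dist_comm] at hnorm
      linarith [dist_pos.2 hpq]
  have hprid : ∀ z, z ≠ p → dist z p ≤ r → pr z = z := by
    intro z hz hd
    have hz' : 0 < ‖z - p‖ := by simpa [sub_eq_zero] using hz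
    simp only [pr]
    rw [min_eq_left]
    · simp
    · rw [le_div_iff₀ hz', one_mul, ← dist_eq_norm]; exact hd
  obtain ⟨n, l, hl, hl'⟩ := punctured p (fun z => g (pr z)) (hg.comp hprc hprm)
    (fun z hz => h0 _ (hprm z hz))
  classical
  let g' : ℂ → ℂ := fun z => if z = p then 1 else g z / ((z - p) ^ n * Complex.exp (l z))
  have hne : ∀ z, z ≠ p → (z - p) ^ n * Complex.exp (l z) ≠ 0 := fun z hz =>
    mul_ne_zero (zpow_ne_zero _ (sub_ne_zero.2 hz)) (Complex.exp_ne_zero _)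
  have hg'1 : ∀ z, dist z p ≤ r → g' z = 1 := by
    intro z hz
    simp only [g']
    split_ifs with h
    · rfl
    · have := hl' z h
      simp only [hprid z h hz] at this
      rw [this, div_self (hne z h)]
  have hg'c : ContinuousOn g' {q}ᶜ := by
    intro z hz
    apply ContinuousAt.continuousWithinAt
    by_cases hzp : z = p
    · have : g' =ᶠ[𝓝 z] fun _ => 1 := by
        rw [hzp]
        filter_upwards [closedBall_mem_nhds p hr0] with y hy using hg'1 y hy
      exact continuousAt_const.congr this.symm
    · have : g' =ᶠ[𝓝 z] fun z => g z / ((z - p) ^ n * Complex.exp (l z)) := by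
        filter_upwards [isOpen_ne.mem_nhds hzp] with y hy
        simp only [g', if_neg hy]
      refine ContinuousAt.congr ?_ this.symm
      have h1 : ContinuousAt g z := hg.continuousAt
        ((Set.toFinite {p, q}).isClosed.isOpen_compl.mem_nhds (by simp [hzp]; exact hz))
      have h2 : ContinuousAt l z := hl.continuousAt (isOpen_compl_singleton.mem_nhds hzp)
      refine h1.div (ContinuousAt.mul (ContinuousAt.zpow₀ (by fun_prop) _ (Or.inl (sub_ne_zero.2 hzp)))
        h2.cexp) (hne z hzp)
  obtain ⟨m, l', hl2, hl2'⟩ := punctured q g' hg'c (by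
    intro z hz
    simp only [g']
    split_ifs with h
    · exact one_ne_zero
    · exact div_ne_zero (h0 z (by simp [h]; exact hz)) (hne z h))
  refine ⟨n, m, fun z => l z + l' z, ?_, ?_⟩
  · refine (hl.mono ?_).add (hl2.mono ?_) <;> intro z <;> simp +contextual
  · intro z hz
    simp only [mem_compl_iff, mem_insert_iff, mem_singleton_iff, not_or] at hz
    have := hl2' z hz.2
    simp only [g', if_neg hz.1] at this
    rw [div_eq_iff (hne z hz.1)] at this
    rw [this, Complex.exp_add]; ring

end CC

namespace CC

lemma sq1 {x : ℂ} (h : x ^ 2 = 1) : x = 1 ∨ x = -1 := by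
  apply sq_eq_sq_iff_eq_or_eq_neg.1; simpa using h

structure Arc {X : Type*} [TopologicalSpace X] (γ : ℝ → X) (a b : ℝ) : Prop where
  lt : a < b
  cont : ContinuousOn γ (Icc a b)
  inj : InjOn γ (Icc a b)

lemma Arc.sub {X : Type*} [TopologicalSpace X] {γ : ℝ → X} {a b : ℝ} (h : Arc γ a b)
    {a' b' : ℝ} (ha : a ≤ a') (hab : a' < b') (hb : b' ≤ b) : Arc γ a' b' :=
  ⟨hab, h.cont.mono (Icc_subset_Icc ha hb), h.inj.mono (Icc_subset_Icc ha hb)⟩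

lemma Arc.isCompact {X : Type*} [TopologicalSpace X] {γ : ℝ → X} {a b : ℝ} (h : Arc γ a b) :
    IsCompact (γ '' Icc a b) := isCompact_Icc.image_of_continuousOn h.cont

lemma Arc.retract {X : Type*} [TopologicalSpace X] [T2Space X] [NormalSpace X]
    {γ : ℝ → X} {a b : ℝ} (h : Arc γ a b) :
    ∃ ρ : X → ℝ, Continuous ρ ∧ (∀ x, ρ x ∈ Icc a b) ∧ ∀ t ∈ Icc a b, ρ (γ t) = t := by
  let e : Icc a b → X := fun t => γ t
  have he : IsClosedEmbedding e := by
    apply Continuous.isClosedEmbedding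
    · exact continuousOn_iff_continuous_domRestrict.1 h.cont
    · exact fun x y hxy => Subtype.ext (h.inj x.2 y.2 hxy)
  obtain ⟨g, hg1, hg⟩ := ContinuousMap.exists_extension_forall_mem_of_isClosedEmbedding
    (⟨fun t : Icc a b => (t : ℝ), by fun_prop⟩ : C(Icc a b, ℝ)) (t := Icc a b)
    (fun x => x.2) (nonempty_Icc.2 h.lt.le) he
  refine ⟨g, g.continuous, hg1, fun t ht => ?_⟩
  have := congrFun hg ⟨t, ht⟩
  simpa [e] using this

lemma rank2 : 1 < Module.rank ℝ ℂ := by rw [Complex.rank_real_complex]; norm_num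

lemma no_inj_sphere (z₀ : ℂ) (r : ℝ) (hr : 0 < r) (ρ : ℂ → ℝ) (hρ : ContinuousOn ρ (sphere z₀ r))
    (hi : InjOn ρ (sphere z₀ r)) : False := by
  let m : ℂ → ℂ := fun z => 2 * z₀ - z
  have hm : ∀ z ∈ sphere z₀ r, m z ∈ sphere z₀ r := by
    intro z hz
    simp only [m, mem_sphere, dist_eq_norm] at hz ⊢
    rw [← hz, ← norm_neg]; congr 1; ring
  have hf : ContinuousOn (fun z => ρ z - ρ (m z)) (sphere z₀ r) :=
    hρ.sub (hρ.comp (by fun_prop) hm)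
  have hz₁ : z₀ + r ∈ sphere z₀ r := by simp [abs_of_pos hr]
  have hc := isPreconnected_sphere rank2 z₀ r
  have : ∃ z ∈ sphere z₀ r, ρ z - ρ (m z) = 0 := by
    have hmm : m (m (z₀ + r)) = z₀ + r := by simp [m]
    rcases le_total 0 (ρ (z₀ + r) - ρ (m (z₀ + r))) with h | h
    · have := hc.intermediate_value (hm _ hz₁) hz₁ hf
      exact this ⟨by simp only [hmm]; linarith, h⟩
    · have := hc.intermediate_value hz₁ (hm _ hz₁) hf
      exact this ⟨h, by simp only [hmm]; linarith⟩
  obtain ⟨z, hz, hz'⟩ := this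
  have := hi hz (hm z hz) (by linarith)
  simp only [m] at this
  have h2 : z = z₀ := by linear_combination this / 2
  rw [h2] at hz
  simp at hz
  exact hr.ne hz

def Surf (X : Type*) [TopologicalSpace X] : Prop :=
  ∀ x : X, ∃ ψ : ℂ → X, IsOpenEmbedding ψ ∧ ψ 0 = x

lemma surf_C : Surf ℂ := fun x => ⟨fun z => z + x, (Homeomorph.addRight x).isOpenEmbedding, by simp⟩

lemma Arc.dense_compl {X : Type*} [TopologicalSpace X] [T2Space X] [NormalSpace X] (hX : Surf X)
    {γ : ℝ → X} {a b : ℝ} (h : Arc γ a b) : Dense (γ '' Icc a b)ᶜ := by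
  rw [← interior_eq_empty_iff_dense_compl, eq_empty_iff_forall_notMem]
  intro x hx
  obtain ⟨ψ, hψ, hψ0⟩ := hX x
  obtain ⟨ρ, hρ, -, hρ'⟩ := h.retract
  have h1 : ψ ⁻¹' (γ '' Icc a b) ∈ 𝓝 (0:ℂ) := by
    apply hψ.continuous.continuousAt
    rw [hψ0]; exact mem_interior_iff_mem_nhds.1 hx
  obtain ⟨r, hr, hr'⟩ := nhds_basis_closedBall.mem_iff.1 h1
  apply no_inj_sphere 0 r hr (fun z => ρ (ψ z)) (hρ.comp hψ.continuous).continuousOn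
  intro y hy z hz hyz
  obtain ⟨t, ht, hty⟩ := hr' (sphere_subset_closedBall hy)
  obtain ⟨s, hs, hsz⟩ := hr' (sphere_subset_closedBall hz)
  simp only [← hty, ← hsz, hρ' t ht, hρ' s hs] at hyz
  apply hψ.injective
  rw [← hty, ← hsz, hyz]

def NJ {X : Type*} [TopologicalSpace X] (h : X → ℂ) (Z : Set X) (q : X) : Prop :=
  ∃ c, ∀ᶠ z in 𝓝[Zᶜ] q, h z = c

lemma NJ.anti {X : Type*} [TopologicalSpace X] {h : X → ℂ} {Z Z' : Set X} {q : X}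
    (hh : NJ h Z q) (hZ : Z ⊆ Z') : NJ h Z' q := by
  obtain ⟨c, hc⟩ := hh
  exact ⟨c, hc.filter_mono (nhdsWithin_mono _ (compl_subset_compl.2 hZ))⟩

lemma sign_lc {X : Type*} [TopologicalSpace X] {b : X → ℂ} {O : Set X} (hO : IsOpen O)
    (hb : ContinuousOn b O) (h1 : ∀ z ∈ O, b z ^ 2 = 1) {q : X} (hq : q ∈ O) :
    ∀ᶠ y in 𝓝 q, b y = b q := by
  have hc : ContinuousAt b q := hb.continuousAt (hO.mem_nhds hq)
  have h2 : ∀ᶠ y in 𝓝 q, dist (b y) (b q) < 1 := hc (ball_mem_nhds _ one_pos)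
  filter_upwards [h2, hO.mem_nhds hq] with y hy hyO
  rw [dist_eq_norm] at hy
  rcases sq1 (h1 y hyO) with h | h <;> rcases sq1 (h1 q hq) with h' | h' <;>
    rw [h, h'] at hy <;> rw [h, h'] <;> norm_num at hy

lemma preconn_outer (R : ℝ) (hR : 0 < R) : IsPreconnected {z : ℂ | R < ‖z‖} := by
  have h1 : IsPreconnected {z : ℂ | Real.log R < z.re} :=
    (convex_halfSpace_re_gt (Real.log R)).isPreconnected
  have h2 := h1.image Complex.exp Complex.continuous_exp.continuousOn
  convert h2 using 1
  ext z
  simp only [mem_ofPred_eq, mem_image]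
  constructor
  · intro hz
    have hz0 : z ≠ 0 := by rintro rfl; simp at hz; linarith
    refine ⟨Complex.log z, ?_, Complex.exp_log hz0⟩
    rw [Complex.log_re]
    exact Real.log_lt_log hR hz
  · rintro ⟨w, hw, rfl⟩
    rw [Complex.norm_exp]
    exact (Real.log_lt_iff_lt_exp hR).1 hw

lemma arc_compl_const {γ : ℝ → ℂ} {a b : ℝ} (h : Arc γ a b) (f : ℂ → ℂ)
    (hf : ContinuousOn f (γ '' Icc a b)ᶜ) (hf1 : ∀ z ∈ (γ '' Icc a b)ᶜ, f z ^ 2 = 1) :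
    ∃ c, ∀ z ∈ (γ '' Icc a b)ᶜ, f z = c := by
  set A := γ '' Icc a b with hA
  have hAc : IsClosed A := h.isCompact.isClosed
  obtain ⟨R, hR0, hR⟩ : ∃ R : ℝ, 0 < R ∧ A ⊆ closedBall 0 R := by
    obtain ⟨R, hR⟩ := h.isCompact.isBounded.subset_closedBall (0:ℂ)
    exact ⟨max R 1, by positivity, hR.trans (closedBall_subset_closedBall (le_max_left _ _))⟩
  have hout : ∀ z : ℂ, R < ‖z‖ → z ∈ Aᶜ := by
    intro z hz hzA
    have := hR hzA
    simp at this; linarith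
  let z₁ : ℂ := ((R + 1 : ℝ) : ℂ)
  have hz₁ : R < ‖z₁‖ := by
    simp only [z₁, Complex.norm_real, Real.norm_eq_abs]; rw [abs_of_pos] <;> linarith
  refine ⟨f z₁, ?_⟩
  have hconst : ∀ z : ℂ, R < ‖z‖ → f z = f z₁ := by
    have hk := sign_const (preconn_outer R hR0) f (fun _ => f z₁)
      (hf.mono hout) continuousOn_const (fun x hx => by rw [hf1 x (hout x hx), hf1 z₁ (hout _ hz₁)])
      (fun x hx h0 => by have := hf1 z₁ (hout _ hz₁); rw [h0] at this; norm_num at this)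
    rcases hk with hk | hk
    · exact hk
    · have := hk z₁ hz₁
      have h3 := hf1 z₁ (hout _ hz₁)
      have h4 : f z₁ = 0 := by linear_combination this / 2
      rw [h4] at h3; norm_num at h3
  by_contra hcon
  push Not at hcon
  obtain ⟨p, hpA, hp⟩ := hcon
  let Q : Set ℂ := {z | z ∉ A ∧ f z ≠ f z₁}
  have hQ : frontier Q ⊆ A := by
    intro z hz
    by_contra hzA
    have hl := sign_lc hAc.isOpen_compl hf hf1 hzA
    have hl2 : ∀ᶠ y in 𝓝 z, y ∉ A := hAc.isOpen_compl.mem_nhds hzA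
    by_cases hzf : f z = f z₁
    · have : Qᶜ ∈ 𝓝 z := by
        filter_upwards [hl] with y hy
        intro hyQ; exact hyQ.2 (hy.trans hzf)
      rw [frontier_eq_closure_inter_closure] at hz
      have := mem_closure_iff_nhds.1 hz.1 _ this
      simp at this
    · have : Q ∈ 𝓝 z := by
        filter_upwards [hl, hl2] with y hy hy2
        exact ⟨hy2, by rw [hy]; exact hzf⟩
      exact hz.2 (mem_interior_iff_mem_nhds.2 this)
  obtain ⟨ρ, hρ, hρI, hρ'⟩ := h.retract
  classical
  let F : ℂ → ℂ := Q.piecewise (fun z => γ (ρ z) - p) (fun z => z - p)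
  have hFc : Continuous F := by
    apply Continuous.piecewise
    · intro z hz
      obtain ⟨t, ht, rfl⟩ := hQ hz
      simp only [hρ' t ht]
    · exact (h.cont.comp_continuous hρ hρI).sub continuous_const
    · fun_prop
  have hF0 : ∀ z, F z ≠ 0 := by
    intro z
    by_cases hz : z ∈ Q
    · simp only [F, piecewise_eq_of_mem _ _ _ hz]
      intro h0
      apply hpA
      rw [← sub_eq_zero.1 h0]
      exact ⟨_, hρI z, rfl⟩
    · simp only [F, piecewise_eq_of_notMem _ _ _ hz]
      intro h0
      rw [sub_eq_zero.1 h0] at hz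
      exact hz ⟨hpA, hp⟩
  obtain ⟨l, hl, hl'⟩ := entire_log F hFc hF0
  apply no_sqrt_sphere p (R + ‖p‖ + 1) (by positivity) (fun z => Complex.exp (l z / 2))
    (by fun_prop)
  intro z hz
  have hzn : R < ‖z‖ := by
    have h1 : ‖z - p‖ = R + ‖p‖ + 1 := by simpa [dist_eq_norm] using hz
    have := norm_sub_le z p
    linarith
  have hzQ : z ∉ Q := fun hzQ => hzQ.2 (hconst z hzn)
  rw [← Complex.exp_nat_mul]
  have : ((2:ℕ):ℂ) * (l z / 2) = l z := by push_cast; ring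
  rw [this, hl']
  simp only [F, piecewise_eq_of_notMem _ _ _ hzQ]

lemma even_of_sq (q : ℂ) (R : ℝ) (hR : 0 < R) (n : ℤ) (s : ℂ → ℂ) (hs : ContinuousOn s (sphere q R))
    (h : ∀ z ∈ sphere q R, (z - q) ^ n = s z ^ 2) : Even n := by
  by_contra hn
  obtain ⟨m, rfl⟩ := Int.not_even_iff_odd.1 hn
  have hne : ∀ z ∈ sphere q R, z - q ≠ 0 := by
    intro z hz h0
    rw [sub_eq_zero.1 h0] at hz
    simp at hz; exact hR.ne hz
  apply no_sqrt_sphere q R hR (fun z => s z / (z - q) ^ m)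
  · refine hs.div (ContinuousOn.zpow₀ (by fun_prop) _ (fun z hz => Or.inl (hne z hz)))
      (fun z hz => zpow_ne_zero _ (hne z hz))
  · intro z hz
    have h0 := hne z hz
    rw [div_pow, ← h z hz, zpow_add₀ h0, zpow_mul, zpow_one, div_eq_iff (pow_ne_zero _ (zpow_ne_zero _ h0))]
    rw [← zpow_natCast ((z-q)^m) 2, ← zpow_mul, ← zpow_mul, mul_comm (2:ℤ) m]
    push_cast; ring

structure MVData (O K : Set ℂ) (ε u v g : ℂ → ℂ) : Prop where
  hu : ContinuousOn u Kᶜ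
  hv : ContinuousOn v O
  hg : ContinuousOn g (O ∪ Kᶜ)
  u0 : ∀ z, u z ≠ 0
  v0 : ∀ z, v z ≠ 0
  gu : ∀ z ∈ Kᶜ, g z = u z ^ 2
  gv : ∀ z ∈ O, g z = v z ^ 2
  uv : ∀ z ∈ O \ K, u z = ε z * v z

lemma MVData.mul {O K : Set ℂ} {ε u v g ε' u' v' g' : ℂ → ℂ} (h : MVData O K ε u v g)
    (h' : MVData O K ε' u' v' g') :
    MVData O K (fun z => ε z * ε' z) (fun z => u z * u' z) (fun z => v z * v' z)
      (fun z => g z * g' z) where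
  hu := h.hu.mul h'.hu
  hv := h.hv.mul h'.hv
  hg := h.hg.mul h'.hg
  u0 z := mul_ne_zero (h.u0 z) (h'.u0 z)
  v0 z := mul_ne_zero (h.v0 z) (h'.v0 z)
  gu z hz := by simp only [h.gu z hz, h'.gu z hz]; ring
  gv z hz := by simp only [h.gv z hz, h'.gv z hz]; ring
  uv z hz := by simp only [h.uv z hz, h'.uv z hz]; ring

lemma exists_MVData {O K : Set ℂ} (hO : IsOpen O) (hOc : Oᶜ.Nonempty) (hK : IsClosed K)
    (hKn : K.Nonempty) (ε : ℂ → ℂ) (hε : ContinuousOn ε (O \ K)) (hε1 : ∀ z ∈ O \ K, ε z ^ 2 = 1) :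
    ∃ u v g, MVData O K ε u v g := by
  classical
  let χ : ℂ → ℝ := fun z => infDist z Oᶜ / (infDist z Oᶜ + infDist z K)
  let h : ℂ → ℝ := fun z => if z ∈ O \ K ∧ ε z = -1 then 1 else 0
  have hh01 : ∀ z, h z = 0 ∨ h z = 1 := by
    intro z; simp only [h]; split_ifs <;> simp
  have hOK : IsOpen (O \ K) := hO.sdiff hK
  have hhc : ∀ z ∈ O \ K, ContinuousAt h z := by
    intro z hz
    have : h =ᶠ[𝓝 z] fun _ => h z := by
      filter_upwards [sign_lc hOK hε hε1 hz, hOK.mem_nhds hz] with y hy hy2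
      simp only [h, hy, hz, hy2, true_and]
    exact continuousAt_const.congr this.symm
  have hO0 : ∀ z, z ∈ O → 0 < infDist z Oᶜ := by
    intro z hz
    exact (hO.isClosed_compl.notMem_iff_infDist_pos hOc).1 (by simpa using hz)
  have hO0' : ∀ z, z ∉ O → infDist z Oᶜ = 0 := fun z hz => infDist_zero_of_mem hz
  have hK0 : ∀ z, z ∉ K → 0 < infDist z K := fun z hz =>
    (hK.notMem_iff_infDist_pos hKn).1 hz
  have hden : ∀ z, z ∈ O ∪ Kᶜ → infDist z Oᶜ + infDist z K ≠ 0 := by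
    intro z hz
    rcases hz with hz | hz
    · have := hO0 z hz; have := infDist_nonneg (x := z) (s := K); positivity
    · have := hK0 z hz; have := infDist_nonneg (x := z) (s := Oᶜ); positivity
  have hχc : ∀ z ∈ O ∪ Kᶜ, ContinuousAt χ z := by
    intro z hz
    have h1 := (continuous_infDist_pt Oᶜ).continuousAt (x := z)
    have h2 := (continuous_infDist_pt K).continuousAt (x := z)
    exact h1.div (h1.add h2) (hden z hz)
  have hχ0 : ∀ z ∉ O, χ z = 0 := by intro z hz; simp [χ, hO0' z hz]
  have hχ1 : ∀ z ∈ O, z ∈ K → χ z = 1 := by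
    intro z hz hzK
    have h2 := (hO0 z hz).ne'
    simp only [χ, infDist_zero_of_mem hzK, add_zero]
    exact div_self h2
  have hbd : ∀ z, |h z| ≤ 1 := by
    intro z; rcases hh01 z with h | h <;> simp [h]
  have hsmall : ∀ (f : ℂ → ℝ) (z : ℂ), ContinuousAt f z → f z = 0 →
      ContinuousAt (fun y => f y * h y) z := by
    intro f z hf hfz
    have : Tendsto (fun y => f y * h y) (𝓝 z) (𝓝 0) := by
      apply squeeze_zero_norm (a := fun y => |f y|)
      · intro y
        rw [norm_mul, Real.norm_eq_abs, Real.norm_eq_abs]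
        calc |f y| * |h y| ≤ |f y| * 1 := by gcongr; exact hbd y
          _ = _ := mul_one _
      · have := hf.abs.tendsto
        simpa [hfz] using this
    simpa [ContinuousAt, hfz] using this
  have hUc : ∀ z ∈ Kᶜ, ContinuousAt (fun y => χ y * h y) z := by
    intro z hz
    by_cases hzO : z ∈ O
    · exact (hχc z (Or.inl hzO)).mul (hhc z ⟨hzO, hz⟩)
    · exact hsmall _ z (hχc z (Or.inr hz)) (hχ0 z hzO)
  have hVc : ∀ z ∈ O, ContinuousAt (fun y => (χ y - 1) * h y) z := by
    intro z hz
    by_cases hzK : z ∈ K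
    · exact hsmall (fun y => χ y - 1) z ((hχc z (Or.inl hz)).sub continuousAt_const)
        (by simp [hχ1 z hz hzK])
    · exact ((hχc z (Or.inl hz)).sub continuousAt_const).mul (hhc z ⟨hz, hzK⟩)
  have hvu : ∀ z, Complex.exp ((((χ z - 1) * h z : ℝ) : ℂ) * (Real.pi * Complex.I)) ^ 2
      = Complex.exp (((χ z * h z : ℝ) : ℂ) * (Real.pi * Complex.I)) ^ 2 := by
    intro z
    rcases hh01 z with h | h
    · simp [h]
    · simp only [h, mul_one]
      push_cast
      rw [sub_mul, Complex.exp_sub, one_mul, Complex.exp_pi_mul_I]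
      ring
  have huc : ContinuousOn (fun z => Complex.exp (((χ z * h z : ℝ) : ℂ) * (Real.pi * Complex.I))) Kᶜ := by
    intro z hz
    have := hUc z hz
    apply ContinuousAt.continuousWithinAt
    exact ((Complex.continuous_ofReal.continuousAt.comp this).mul continuousAt_const).cexp
  have hvc : ContinuousOn (fun z => Complex.exp ((((χ z - 1) * h z : ℝ) : ℂ) * (Real.pi * Complex.I))) O := by
    intro z hz
    have := hVc z hz
    apply ContinuousAt.continuousWithinAt
    exact ((Complex.continuous_ofReal.continuousAt.comp this).mul continuousAt_const).cexp
  refine ⟨fun z => Complex.exp (((χ z * h z : ℝ) : ℂ) * (Real.pi * Complex.I)),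
    fun z => Complex.exp ((((χ z - 1) * h z : ℝ) : ℂ) * (Real.pi * Complex.I)),
    fun z => Complex.exp (((χ z * h z : ℝ) : ℂ) * (Real.pi * Complex.I)) ^ 2,
    huc, hvc, ?_, fun z => Complex.exp_ne_zero _, fun z => Complex.exp_ne_zero _,
    fun z _ => rfl, fun z _ => (hvu z).symm, ?_⟩
  · apply ContinuousOn.union_of_isOpen
    · exact (hvc.pow 2).congr (fun z _ => (hvu z).symm)
    · exact huc.pow 2
    · exact hO
    · exact hK.isOpen_compl
  · intro z hz
    rcases sq1 (hε1 z hz) with h1 | h1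
    · have : h z = 0 := by
        simp only [h]; rw [if_neg]; rw [h1]; norm_num
      simp [this, h1]
    · have : h z = 1 := by
        simp only [h]; rw [if_pos ⟨hz, h1⟩]
      simp only [this, h1, mul_one]
      push_cast
      rw [sub_mul, Complex.exp_sub, one_mul, Complex.exp_pi_mul_I]
      ring

lemma MVData.finish {O : Set ℂ} {γ : ℝ → ℂ} {a b : ℝ} (hγ : Arc γ a b) (hO : IsOpen O)
    {ε u v g : ℂ → ℂ} (h : MVData O (γ '' Icc a b) ε u v g) (w : ℂ → ℂ)
    (hw : ContinuousOn w (O ∪ (γ '' Icc a b)ᶜ)) (hwg : ∀ z ∈ O ∪ (γ '' Icc a b)ᶜ, g z = w z ^ 2)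
    {q : ℂ} (hq : q ∈ O) : NJ ε (γ '' Icc a b) q := by
  set K := γ '' Icc a b
  have hw0 : ∀ z ∈ O ∪ Kᶜ, w z ≠ 0 := by
    intro z hz h0
    have h1 := hwg z hz
    rw [h0] at h1
    rcases hz with hz | hz
    · rw [h.gv z hz] at h1
      exact h.v0 z (by simpa using h1)
    · rw [h.gu z hz] at h1
      exact h.u0 z (by simpa using h1)
  obtain ⟨c, hc⟩ := arc_compl_const hγ (fun z => u z / w z)
    (h.hu.div (hw.mono subset_union_right) (fun z hz => hw0 z (Or.inr hz)))
    (fun z hz => by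
      rw [div_pow, ← h.gu z hz, ← hwg z (Or.inr hz), div_self]
      rw [h.gu z hz]; exact pow_ne_zero _ (h.u0 z))
  have hlc := sign_lc (b := fun z => w z / v z) hO
    ((hw.mono subset_union_left).div h.hv (fun z _ => h.v0 z))
    (fun z hz => by
      rw [div_pow, ← hwg z (Or.inl hz), h.gv z hz, div_self]
      exact pow_ne_zero _ (h.v0 z)) hq
  refine ⟨c * (w q / v q), ?_⟩
  filter_upwards [nhdsWithin_le_nhds hlc, nhdsWithin_le_nhds (hO.mem_nhds hq), self_mem_nhdsWithin]
    with z hz1 hz2 hz3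
  rw [← hz1, ← hc z hz3]
  have h1 := h.uv z ⟨hz2, hz3⟩
  have h2 := hw0 z (Or.inr hz3)
  have h3 := h.v0 z
  rw [h1]
  field_simp

end CC

namespace CC

lemma exp_half (x : ℂ) : Complex.exp (x / 2) ^ 2 = Complex.exp x := by
  rw [← Complex.exp_nat_mul]; congr 1; push_cast; ring

/-- near a parameter, an arc stays in a neighbourhood -/
lemma Arc.near {X : Type*} [TopologicalSpace X] {γ : ℝ → X} {a b : ℝ} (h : Arc γ a b) {t : ℝ}
    (ht : t ∈ Icc a b) {O : Set X} (hO : O ∈ 𝓝 (γ t)) :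
    ∃ δ > 0, ∀ s ∈ Icc a b, |s - t| ≤ δ → γ s ∈ O := by
  have h1 := h.cont t ht hO
  rw [mem_map, mem_nhdsWithin_iff_exists_mem_nhds_inter] at h1
  obtain ⟨u, hu, hu'⟩ := h1
  obtain ⟨δ, hδ, hδ'⟩ := nhds_basis_closedBall.mem_iff.1 hu
  exact ⟨δ, hδ, fun s hs hst => hu' ⟨hδ' (by simpa [Real.dist_eq] using hst), hs⟩⟩

lemma exists_big_sphere (q : ℂ) {K : Set ℂ} (hK : IsCompact K) :
    ∃ R : ℝ, 0 < R ∧ ∀ z ∈ sphere q R, z ∈ Kᶜ := by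
  obtain ⟨R, hR⟩ := hK.isBounded.subset_closedBall q
  refine ⟨max R 0 + 1, by positivity, fun z hz hzK => ?_⟩
  have h1 := hR hzK
  rw [mem_sphere] at hz
  rw [mem_closedBall, hz] at h1
  linarith [le_max_left R 0]

lemma arc_sqrt {γ : ℝ → ℂ} {a b : ℝ} (h : Arc γ a b) :
    ∃ ρ : ℂ → ℂ, ContinuousOn ρ (γ '' Icc a b)ᶜ ∧ (∀ z, ρ z ≠ 0) ∧
      ∀ z ∈ (γ '' Icc a b)ᶜ, ρ z ^ 2 = (z - γ a) / (z - γ b) := by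
  set K := γ '' Icc a b with hK
  have hmem : ∀ s : unitInterval, b + s * (a - b) ∈ Icc a b := by
    intro s
    have h0 := s.2.1
    have h1 := s.2.2
    have := h.lt
    constructor <;> nlinarith
  have hc : Continuous fun s : unitInterval => γ (b + s * (a - b)) :=
    h.cont.comp_continuous (by fun_prop) hmem
  have hne : ∀ z : (Kᶜ : Set ℂ), ∀ t ∈ Icc a b, (z : ℂ) - γ t ≠ 0 := by
    intro z t ht h0
    exact z.2 ⟨t, ht, (sub_eq_zero.1 h0).symm⟩
  have hb : b ∈ Icc a b := right_mem_Icc.2 h.lt.le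
  obtain ⟨l, hl, hl'⟩ := homotopy_log (X := (Kᶜ : Set ℂ))
    (fun p => ((p.2 : ℂ) - γ (b + p.1 * (a - b))) / ((p.2 : ℂ) - γ b))
    (by
      apply Continuous.div
      · exact (continuous_subtype_val.comp continuous_snd).sub (hc.comp continuous_fst)
      · fun_prop
      · intro p; exact hne _ _ hb)
    (fun p => div_ne_zero (hne _ _ (hmem _)) (hne _ _ hb))
    (fun x => by simp [div_self (hne x b hb)])
  classical
  refine ⟨fun z => if hz : z ∈ Kᶜ then Complex.exp (l ⟨z, hz⟩ / 2) else 1, ?_, ?_, ?_⟩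
  · rw [continuousOn_iff_continuous_domRestrict]
    have : (Kᶜ).domRestrict (fun z => if hz : z ∈ Kᶜ then Complex.exp (l ⟨z, hz⟩ / 2) else 1)
        = fun z => Complex.exp (l z / 2) := by
      funext z
      have hz := z.2
      simp only [Set.domRestrict]
      rw [dif_pos hz]
    rw [this]; fun_prop
  · intro z; dsimp only; split_ifs
    · exact Complex.exp_ne_zero _
    · exact one_ne_zero
  · intro z hz
    simp only [dif_pos hz]
    rw [exp_half, hl']
    simp

/-- endpoint lemma in the plane -/
lemma endpoint_plane {γ : ℝ → ℂ} {a b : ℝ} (h : Arc γ a b) {O : Set ℂ} (hO : IsOpen O)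
    (hq : γ a ∈ O) (ε : ℂ → ℂ) (hε : ContinuousOn ε (O \ γ '' Icc a b))
    (hε1 : ∀ z ∈ O \ γ '' Icc a b, ε z ^ 2 = 1) : NJ ε (γ '' Icc a b) (γ a) := by
  set O1 := O ∩ ball (γ a) 1 with hO1
  have hO1o : IsOpen O1 := hO.inter isOpen_ball
  have ha : a ∈ Icc a b := left_mem_Icc.2 h.lt.le
  obtain ⟨δ, hδ, hδ'⟩ := h.near ha (hO1o.mem_nhds ⟨hq, mem_ball_self one_pos⟩)
  have hlt := h.lt
  obtain ⟨b', hab', hbbx, hb'δ⟩ : ∃ b', a < b' ∧ b' < b ∧ b' ≤ a + δ :=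
    ⟨min ((a+b)/2) (a + δ), lt_min (by linarith) (by linarith),
      (min_le_left _ _).trans_lt (by linarith), min_le_right _ _⟩
  have h1 : Arc γ a b' := h.sub le_rfl hab' hbbx.le
  have h2 : Arc γ b' b := h.sub hab'.le hbbx le_rfl
  set K := γ '' Icc a b' with hK
  set O' := O1 \ γ '' Icc b' b with hO'
  have hO'o : IsOpen O' := hO1o.sdiff h2.isCompact.isClosed
  have hKc : IsClosed K := h1.isCompact.isClosed
  have hsub : O' \ K ⊆ O \ γ '' Icc a b := by
    rintro z ⟨⟨hz1, hz2⟩, hz3⟩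
    refine ⟨hz1.1, ?_⟩
    rintro ⟨t, ht, rfl⟩
    rcases le_total t b' with h | h
    · exact hz3 ⟨t, ⟨ht.1, h⟩, rfl⟩
    · exact hz2 ⟨t, ⟨h, ht.2⟩, rfl⟩
  have hcov1 : ∀ t ∈ Ico a b', γ t ∈ O' := by
    intro t ht
    refine ⟨hδ' t ⟨ht.1, ht.2.le.trans hbbx.le⟩ ?_, ?_⟩
    · rw [abs_of_nonneg (by linarith [ht.1])]; linarith [ht.2]
    · rintro ⟨s, hs, hst⟩
      have := h.inj ⟨hab'.le.trans hs.1, hs.2⟩ ⟨ht.1, ht.2.le.trans hbbx.le⟩ hst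
      linarith [hs.1, ht.2]
  have hcov : ({γ b'}ᶜ : Set ℂ) = O' ∪ Kᶜ := by
    ext z
    constructor
    · intro hz
      by_cases hzK : z ∈ K
      · obtain ⟨t, ht, rfl⟩ := hzK
        left
        apply hcov1 t ⟨ht.1, lt_of_le_of_ne ht.2 _⟩
        rintro rfl; exact hz rfl
      · right; exact hzK
    · rintro (hz | hz) rfl
      · exact hz.2 ⟨b', ⟨le_rfl, hbbx.le⟩, rfl⟩
      · exact hz ⟨b', ⟨hab'.le, le_rfl⟩, rfl⟩
  have hOc : O'ᶜ.Nonempty := by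
    refine ⟨γ a + 1, fun hz => ?_⟩
    have := hz.1.2
    simp at this
  obtain ⟨u, v, g, D⟩ := exists_MVData hO'o hOc hKc ⟨γ a, a, ⟨le_rfl, hab'.le⟩, rfl⟩ ε
    (hε.mono hsub) (fun z hz => hε1 z (hsub hz))
  obtain ⟨n, l, hl, hl'⟩ := punctured (γ b') g (by rw [hcov]; exact D.hg) (by
    intro z hz
    rw [hcov] at hz
    rcases hz with hz | hz
    · rw [D.gv z hz]; exact pow_ne_zero _ (D.v0 z)
    · rw [D.gu z hz]; exact pow_ne_zero _ (D.u0 z))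
  have hne : ∀ z ∈ ({γ b'}ᶜ : Set ℂ), z - γ b' ≠ 0 := fun z hz => sub_ne_zero.2 hz
  obtain ⟨R, hR, hRK⟩ := exists_big_sphere (γ b') h1.isCompact
  have hRs : ∀ z ∈ sphere (γ b') R, z ∈ ({γ b'}ᶜ : Set ℂ) := by
    intro z hz; rw [hcov]; right; exact hRK z hz
  have hev : Even n := by
    apply even_of_sq (γ b') R hR n (fun z => u z / Complex.exp (l z / 2))
    · exact (D.hu.mono hRK).div ((hl.mono hRs).div_const 2).cexp (fun z _ => Complex.exp_ne_zero _)
    · intro z hz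
      rw [div_pow, exp_half, ← D.gu z (hRK z hz), hl' z (hRs z hz), mul_div_cancel_right₀ _ (Complex.exp_ne_zero _)]
  obtain ⟨m, rfl⟩ := hev
  have hfin := D.finish h1 hO'o (fun z => (z - γ b') ^ m * Complex.exp (l z / 2)) (by
      rw [← hcov]
      refine ContinuousOn.mul (ContinuousOn.zpow₀ (by fun_prop) _ (fun z hz => Or.inl (hne z hz)))
        (hl.div_const 2).cexp)
    (fun z hz => by
      rw [← hcov] at hz
      rw [hl' z hz, mul_pow, exp_half, zpow_add₀ (hne z hz)]; ring)
    (hcov1 a ⟨le_rfl, hab'⟩)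
  exact hfin.anti (image_mono (Icc_subset_Icc le_rfl hbbx.le))

/-- two-sidedness in the plane -/
lemma two_sided_plane {γ : ℝ → ℂ} {a b : ℝ} (h : Arc γ a b) {t₀ : ℝ} (ht₀ : t₀ ∈ Ioo a b)
    {O : Set ℂ} (hO : IsOpen O)
    (hq : γ t₀ ∈ O) (ε₁ ε₂ : ℂ → ℂ) (hε₁ : ContinuousOn ε₁ (O \ γ '' Icc a b))
    (hε₁1 : ∀ z ∈ O \ γ '' Icc a b, ε₁ z ^ 2 = 1)
    (hε₂ : ContinuousOn ε₂ (O \ γ '' Icc a b))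
    (hε₂1 : ∀ z ∈ O \ γ '' Icc a b, ε₂ z ^ 2 = 1)
    (hj₁ : ¬ NJ ε₁ (γ '' Icc a b) (γ t₀)) (hj₂ : ¬ NJ ε₂ (γ '' Icc a b) (γ t₀)) :
    NJ (fun z => ε₁ z * ε₂ z) (γ '' Icc a b) (γ t₀) := by
  set O1 := O ∩ ball (γ t₀) 1 with hO1
  have hO1o : IsOpen O1 := hO.inter isOpen_ball
  obtain ⟨δ, hδ, hδ'⟩ := h.near ⟨ht₀.1.le, ht₀.2.le⟩ (hO1o.mem_nhds ⟨hq, mem_ball_self one_pos⟩)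
  obtain ⟨hat, htb⟩ := ht₀
  obtain ⟨b', htb', hbbx, hb'δ⟩ : ∃ b', t₀ < b' ∧ b' < b ∧ b' ≤ t₀ + δ :=
    ⟨min ((t₀+b)/2) (t₀ + δ), lt_min (by linarith) (by linarith),
      (min_le_left _ _).trans_lt (by linarith), min_le_right _ _⟩
  obtain ⟨a', hta', ha'a, ha'δ⟩ : ∃ a', a' < t₀ ∧ a < a' ∧ t₀ - δ ≤ a' :=
    ⟨max ((t₀+a)/2) (t₀ - δ), max_lt (by linarith) (by linarith),
      lt_of_lt_of_le (by linarith) (le_max_left _ _), le_max_right _ _⟩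
  have hab' : a' < b' := hta'.trans htb'
  have h1 : Arc γ a' b' := h.sub ha'a.le hab' hbbx.le
  have h2 : Arc γ b' b := h.sub (ha'a.le.trans hab'.le) hbbx le_rfl
  have h3 : Arc γ a a' := h.sub le_rfl ha'a (hab'.le.trans hbbx.le)
  set K := γ '' Icc a' b' with hK
  set O' := O1 \ (γ '' Icc b' b ∪ γ '' Icc a a') with hO'
  have hO'o : IsOpen O' := hO1o.sdiff (h2.isCompact.isClosed.union h3.isCompact.isClosed)
  have hKc : IsClosed K := h1.isCompact.isClosed
  have hsub : O' \ K ⊆ O \ γ '' Icc a b := by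
    rintro z ⟨⟨hz1, hz2⟩, hz3⟩
    refine ⟨hz1.1, ?_⟩
    rintro ⟨t, ht, rfl⟩
    rcases le_total t b' with h | h
    · rcases le_total a' t with h' | h'
      · exact hz3 ⟨t, ⟨h', h⟩, rfl⟩
      · exact hz2 (Or.inr ⟨t, ⟨ht.1, h'⟩, rfl⟩)
    · exact hz2 (Or.inl ⟨t, ⟨h, ht.2⟩, rfl⟩)
  have hcov1 : ∀ t ∈ Ioo a' b', γ t ∈ O' := by
    intro t ht
    have htI : t ∈ Icc a b := ⟨(ha'a.trans ht.1).le, ht.2.le.trans hbbx.le⟩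
    refine ⟨hδ' t htI ?_, ?_⟩
    · rw [abs_le]; constructor <;> linarith [ht.1, ht.2]
    · rintro (⟨s, hs, hst⟩ | ⟨s, hs, hst⟩)
      · have := h.inj ⟨(ha'a.trans hab').le.trans hs.1, hs.2⟩ htI hst
        linarith [hs.1, ht.2]
      · have := h.inj ⟨hs.1, hs.2.trans (hab'.trans hbbx).le⟩ htI hst
        linarith [hs.2, ht.1]
  have hcov : ({γ a', γ b'}ᶜ : Set ℂ) = O' ∪ Kᶜ := by
    ext z
    constructor
    · intro hz
      by_cases hzK : z ∈ K
      · obtain ⟨t, ht, rfl⟩ := hzK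
        left
        apply hcov1 t ⟨lt_of_le_of_ne ht.1 _, lt_of_le_of_ne ht.2 _⟩
        · rintro rfl; exact hz (by simp)
        · rintro rfl; exact hz (by simp)
      · right; exact hzK
    · rintro (hz | hz) (rfl | rfl)
      · exact hz.2 (Or.inr ⟨a', ⟨ha'a.le, le_rfl⟩, rfl⟩)
      · exact hz.2 (Or.inl ⟨b', ⟨le_rfl, hbbx.le⟩, rfl⟩)
      · exact hz ⟨a', ⟨le_rfl, hab'.le⟩, rfl⟩
      · exact hz ⟨b', ⟨hab'.le, le_rfl⟩, rfl⟩
  have hOc : O'ᶜ.Nonempty := by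
    refine ⟨γ t₀ + 1, fun hz => ?_⟩
    have := hz.1.2
    simp at this
  have hpq : γ a' ≠ γ b' := fun he => hab'.ne
    (h1.inj (left_mem_Icc.2 hab'.le) (right_mem_Icc.2 hab'.le) he)
  have hnea : ∀ z ∈ ({γ a', γ b'}ᶜ : Set ℂ), z - γ a' ≠ 0 := fun z hz h0 => hz (by
    rw [sub_eq_zero.1 h0]; simp)
  have hneb : ∀ z ∈ ({γ a', γ b'}ᶜ : Set ℂ), z - γ b' ≠ 0 := fun z hz h0 => hz (by
    rw [sub_eq_zero.1 h0]; simp)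
  obtain ⟨R, hR, hRK⟩ := exists_big_sphere (γ b') h1.isCompact
  have hRs : ∀ z ∈ sphere (γ b') R, z ∈ ({γ a', γ b'}ᶜ : Set ℂ) := by
    intro z hz; rw [hcov]; right; exact hRK z hz
  obtain ⟨ρ, hρc, hρ0, hρ⟩ := arc_sqrt h1
  have htO' : γ t₀ ∈ O' := hcov1 t₀ ⟨hta', htb'⟩
  have hKsub : K ⊆ γ '' Icc a b := image_mono (Icc_subset_Icc ha'a.le hbbx.le)
  have key : ∀ ε : ℂ → ℂ, ContinuousOn ε (O \ γ '' Icc a b) →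
      (∀ z ∈ O \ γ '' Icc a b, ε z ^ 2 = 1) → ∃ u v g, MVData O' K ε u v g ∧
        ∃ (n m : ℤ) (l : ℂ → ℂ), Even (n + m) ∧ ContinuousOn l ({γ a', γ b'}ᶜ : Set ℂ) ∧
        ∀ z ∈ ({γ a', γ b'}ᶜ : Set ℂ), g z = (z - γ a') ^ n * (z - γ b') ^ m * Complex.exp (l z) := by
    intro ε hε hε1
    obtain ⟨u, v, g, D⟩ := exists_MVData hO'o hOc hKc ⟨γ a', a', ⟨le_rfl, hab'.le⟩, rfl⟩ ε
      (hε.mono hsub) (fun z hz => hε1 z (hsub hz))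
    obtain ⟨n, m, l, hl, hl'⟩ := punctured2 (γ a') (γ b') hpq g (by rw [hcov]; exact D.hg) (by
      intro z hz
      rw [hcov] at hz
      rcases hz with hz | hz
      · rw [D.gv z hz]; exact pow_ne_zero _ (D.v0 z)
      · rw [D.gu z hz]; exact pow_ne_zero _ (D.u0 z))
    refine ⟨u, v, g, D, n, m, l, ?_, hl, hl'⟩
    apply even_of_sq (γ b') R hR (n + m) (fun z => u z / (ρ z ^ n * Complex.exp (l z / 2)))
    · refine (D.hu.mono hRK).div (ContinuousOn.mul ((hρc.mono hRK).zpow₀ _ (fun z _ => Or.inl (hρ0 z)))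
        ((hl.mono hRs).div_const 2).cexp) (fun z _ => mul_ne_zero (zpow_ne_zero _ (hρ0 z))
          (Complex.exp_ne_zero _))
    · intro z hz
      have hb0 := hneb z (hRs z hz)
      have ha0 := hnea z (hRs z hz)
      have e1 : (ρ z ^ n) ^ 2 = (z - γ a') ^ n / (z - γ b') ^ n := by
        rw [← div_zpow, ← hρ z (hRK z hz), ← zpow_natCast, ← zpow_natCast, ← zpow_mul, ← zpow_mul, mul_comm]
      rw [div_pow, mul_pow, exp_half, e1, ← D.gu z (hRK z hz), hl' z (hRs z hz), zpow_add₀ hb0]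
      have := Complex.exp_ne_zero (l z)
      have := zpow_ne_zero n ha0
      have := zpow_ne_zero n hb0
      field_simp
  have fin : ∀ (ε u v g : ℂ → ℂ), MVData O' K ε u v g → ∀ (n m : ℤ) (l : ℂ → ℂ), Even n → Even m →
      ContinuousOn l ({γ a', γ b'}ᶜ : Set ℂ) →
      (∀ z ∈ ({γ a', γ b'}ᶜ : Set ℂ), g z = (z - γ a') ^ n * (z - γ b') ^ m * Complex.exp (l z)) →
      NJ ε (γ '' Icc a b) (γ t₀) := by
    rintro ε u v g D n m l ⟨i, rfl⟩ ⟨j, rfl⟩ hl hl'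
    have hfin := D.finish h1 hO'o (fun z => (z - γ a') ^ i * (z - γ b') ^ j * Complex.exp (l z / 2)) (by
        rw [← hcov]
        refine ContinuousOn.mul (ContinuousOn.mul
          (ContinuousOn.zpow₀ (by fun_prop) _ (fun z hz => Or.inl (hnea z hz)))
          (ContinuousOn.zpow₀ (by fun_prop) _ (fun z hz => Or.inl (hneb z hz))))
          (hl.div_const 2).cexp)
      (fun z hz => by
        rw [← hcov] at hz
        rw [hl' z hz, mul_pow, mul_pow, exp_half, zpow_add₀ (hnea z hz), zpow_add₀ (hneb z hz)]; ring)
      htO'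
    exact hfin.anti hKsub
  obtain ⟨u₁, v₁, g₁, D₁, n₁, m₁, l₁, he₁, hl₁, hl₁'⟩ := key ε₁ hε₁ hε₁1
  obtain ⟨u₂, v₂, g₂, D₂, n₂, m₂, l₂, he₂, hl₂, hl₂'⟩ := key ε₂ hε₂ hε₂1
  have hn₁ : ¬ Even n₁ := fun hn => hj₁ (fin ε₁ u₁ v₁ g₁ D₁ n₁ m₁ l₁ hn
    ((Int.even_add.1 he₁).1 hn) hl₁ hl₁')
  have hn₂ : ¬ Even n₂ := fun hn => hj₂ (fin ε₂ u₂ v₂ g₂ D₂ n₂ m₂ l₂ hn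
    ((Int.even_add.1 he₂).1 hn) hl₂ hl₂')
  have hm₁ : ¬ Even m₁ := fun hm => hn₁ ((Int.even_add.1 he₁).2 hm)
  have hm₂ : ¬ Even m₂ := fun hm => hn₂ ((Int.even_add.1 he₂).2 hm)
  refine fin _ _ _ _ (D₁.mul D₂) (n₁ + n₂) (m₁ + m₂) (fun z => l₁ z + l₂ z) ?_ ?_ (hl₁.add hl₂) ?_
  · rw [Int.even_add]; simp [hn₁, hn₂]
  · rw [Int.even_add]; simp [hm₁, hm₂]
  · intro z hz
    rw [hl₁' z hz, hl₂' z hz, zpow_add₀ (hnea z hz), zpow_add₀ (hneb z hz), Complex.exp_add]; ring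

end CC

namespace CC

/-- sign germ off `Z` at `q` -/
def SG {X : Type*} [TopologicalSpace X] (ε : X → ℂ) (Z : Set X) (q : X) : Prop :=
  ∀ᶠ z in 𝓝[Zᶜ] q, ε z ^ 2 = 1 ∧ ContinuousAt ε z

section general
variable {X : Type*} [TopologicalSpace X]

lemma SG.exists_open {ε : X → ℂ} {Z : Set X} {q : X} (h : SG ε Z q) :
    ∃ O : Set X, IsOpen O ∧ q ∈ O ∧ ∀ z ∈ O \ Z, ε z ^ 2 = 1 ∧ ContinuousAt ε z := by
  rw [SG, eventually_nhdsWithin_iff] at h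
  obtain ⟨O, hO, hOo, hq⟩ := eventually_nhds_iff.1 h
  exact ⟨O, hOo, hq, fun z hz => hO z hz.1 hz.2⟩

lemma SG.eventually {ε : X → ℂ} {Z : Set X} {q : X} (h : SG ε Z q) :
    ∀ᶠ p in 𝓝 q, SG ε Z p := eventually_nhds_nhdsWithin.2 h

lemma NJ.eventually {ε : X → ℂ} {Z : Set X} {q : X} (h : NJ ε Z q) :
    ∀ᶠ p in 𝓝 q, NJ ε Z p := by
  obtain ⟨c, hc⟩ := h
  filter_upwards [eventually_nhds_nhdsWithin.2 hc] with p hp using ⟨c, hp⟩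

lemma NJ.congr {ε ε' : X → ℂ} {Z : Set X} {q : X} (h : NJ ε Z q)
    (he : ∀ᶠ z in 𝓝[Zᶜ] q, ε' z = ε z) : NJ ε' Z q := by
  obtain ⟨c, hc⟩ := h
  exact ⟨c, by filter_upwards [hc, he] with z h1 h2 using h2.trans h1⟩

lemma nhdsWithin_compl_congr {Z Z' : Set X} {q : X} (h : ∀ᶠ z in 𝓝 q, (z ∈ Z ↔ z ∈ Z')) :
    𝓝[Zᶜ] q = 𝓝[Z'ᶜ] q := by
  rw [nhdsWithin_eq_iff_eventuallyEq]
  filter_upwards [h] with z hz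
  exact propext (not_congr hz)

lemma compl_ne_bot {Z : Set X} (hZ : Dense Zᶜ) (q : X) : (𝓝[Zᶜ] q).NeBot :=
  mem_closure_iff_nhdsWithin_neBot.1 (hZ q)

lemma NJ_of_SG_off {ε : X → ℂ} {Z : Set X} (hZ : IsClosed Z) {q : X} (h : SG ε Z q) (hq : q ∉ Z) :
    NJ ε Z q := by
  obtain ⟨O, hO, hqO, h1⟩ := h.exists_open
  have h2 := sign_lc (hO.sdiff hZ) (fun z hz => (h1 z hz).2.continuousWithinAt)
    (fun z hz => (h1 z hz).1) (q := q) ⟨hqO, hq⟩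
  exact ⟨ε q, h2.filter_mono nhdsWithin_le_nhds⟩

lemma nhdsWithin_open_embedding {ψ : ℂ → X} (hψ : IsOpenEmbedding ψ) (Z : Set X) (z₀ : ℂ) :
    map ψ (𝓝[(ψ ⁻¹' Z)ᶜ] z₀) = 𝓝[Zᶜ] (ψ z₀) := by
  rw [← preimage_compl]
  exact hψ.map_nhdsWithin_preimage_eq _ _

lemma NJ_chart {ψ : ℂ → X} (hψ : IsOpenEmbedding ψ) {ε : X → ℂ} {Z : Set X} {z₀ : ℂ} :
    NJ (ε ∘ ψ) (ψ ⁻¹' Z) z₀ ↔ NJ ε Z (ψ z₀) := by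
  unfold NJ
  simp only [← nhdsWithin_open_embedding hψ, eventually_map, Function.comp]

lemma SG_chart {ψ : ℂ → X} (hψ : IsOpenEmbedding ψ) {ε : X → ℂ} {Z : Set X} {z₀ : ℂ} :
    SG (ε ∘ ψ) (ψ ⁻¹' Z) z₀ ↔ SG ε Z (ψ z₀) := by
  unfold SG
  simp only [← nhdsWithin_open_embedding hψ, eventually_map, Function.comp_apply,
    hψ.continuousAt_iff]

lemma SG.congr_set {ε : X → ℂ} {Z Z' : Set X} {q : X} (h : ∀ᶠ z in 𝓝 q, (z ∈ Z ↔ z ∈ Z')) :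
    SG ε Z q ↔ SG ε Z' q := by
  unfold SG; rw [nhdsWithin_compl_congr h]

lemma NJ.congr_set {ε : X → ℂ} {Z Z' : Set X} {q : X} (h : ∀ᶠ z in 𝓝 q, (z ∈ Z ↔ z ∈ Z')) :
    NJ ε Z q ↔ NJ ε Z' q := by
  unfold NJ; rw [nhdsWithin_compl_congr h]

/-- EXT -/
lemma NJ_ext {B Z : Set X} (hB : IsPreconnected B) (hBo : IsOpen B) (hZ : Dense Zᶜ) (hZc : IsClosed Z)
    {η : X → ℂ} (h : ∀ q ∈ B, NJ η Z q) : ∃ c, ∀ z ∈ B \ Z, η z = c := by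
  classical
  choose! c hc using h
  have hlc : ∀ q ∈ B, ∀ᶠ p in 𝓝 q, p ∈ B → c p = c q := by
    intro q hq
    filter_upwards [eventually_nhds_nhdsWithin.2 (hc q hq)] with p hp hpB
    haveI := compl_ne_bot hZ p
    obtain ⟨z, h1, h2⟩ := ((hc p hpB).and hp).exists
    rw [← h1, h2]
  have hco : ∀ z ∈ B \ Z, η z = c z := by
    intro z hz
    have := hc z hz.1
    rw [(hZc.isOpen_compl.nhdsWithin_eq hz.2)] at this
    exact this.self_of_nhds
  rcases B.eq_empty_or_nonempty with rfl | ⟨x, hx⟩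
  · exact ⟨0, fun z hz => hz.1.elim⟩
  refine ⟨c x, fun z hz => ?_⟩
  rw [hco z hz]
  refine hB.induction₂ (fun p q => c q = c p) ?_ ?_ ?_ hx hz.1
  · intro q hq
    filter_upwards [mem_nhdsWithin_of_mem_nhds (hlc q hq), self_mem_nhdsWithin] with p hp hpB
    exact hp hpB
  · intro p q r _ _ _ h1 h2
    exact h2.trans h1
  · intro p q _ _ h1
    exact h1.symm

variable [T2Space X] [NormalSpace X]

lemma Arc.local_eq {γ : ℝ → X} {a b a' b' t : ℝ} (h : Arc γ a b)
    (hsub : Icc a' b' ⊆ Icc a b) (ht : t ∈ Icc a b) (hn : Icc a' b' ∈ 𝓝[Icc a b] t) :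
    ∀ᶠ z in 𝓝 (γ t), (z ∈ γ '' Icc a b ↔ z ∈ γ '' Icc a' b') := by
  obtain ⟨ρ, hρ, -, hρ'⟩ := h.retract
  obtain ⟨u, hu, hu'⟩ := mem_nhdsWithin_iff_exists_mem_nhds_inter.1 hn
  rw [← hρ' t ht] at hu
  filter_upwards [hρ.continuousAt hu] with z hz
  constructor
  · rintro ⟨s, hs, rfl⟩
    refine ⟨s, hu' ⟨?_, hs⟩, rfl⟩
    have : ρ (γ s) ∈ u := hz
    rwa [hρ' s hs] at this
  · rintro ⟨s, hs, rfl⟩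
    exact ⟨s, hsub hs, rfl⟩

lemma Arc.chart_mk {γ : ℝ → X} {a b : ℝ} (h : Arc γ a b) {ψ : ℂ → X} (hψ : IsOpenEmbedding ψ)
    (hr : ∀ s ∈ Icc a b, γ s ∈ range ψ) :
    ∃ β : ℝ → ℂ, Arc β a b ∧ (∀ s ∈ Icc a b, ψ (β s) = γ s) ∧
      ψ ⁻¹' (γ '' Icc a b) = β '' Icc a b := by
  have h1 : ∀ s, ∃ z, s ∈ Icc a b → ψ z = γ s := by
    intro s
    by_cases hs : s ∈ Icc a b
    · obtain ⟨z, hz⟩ := hr s hs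
      exact ⟨z, fun _ => hz⟩
    · exact ⟨0, fun h => (hs h).elim⟩
  choose β hβ using h1
  refine ⟨β, ⟨h.lt, ?_, ?_⟩, hβ, ?_⟩
  · rw [hψ.isInducing.continuousOn_iff]
    exact h.cont.congr fun s hs => hβ s hs
  · intro s hs t ht hst
    apply h.inj hs ht
    rw [← hβ s hs, ← hβ t ht, hst]
  · ext z
    constructor
    · rintro ⟨s, hs, hz⟩
      exact ⟨s, hs, hψ.injective (by rw [hβ s hs, hz])⟩
    · rintro ⟨s, hs, rfl⟩
      exact ⟨s, hs, (hβ s hs).symm⟩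

lemma Arc.reverse {γ : ℝ → X} {a b : ℝ} (h : Arc γ a b) :
    Arc (fun t => γ (a + b - t)) a b ∧ (fun t => γ (a + b - t)) '' Icc a b = γ '' Icc a b := by
  have hm : ∀ t ∈ Icc a b, a + b - t ∈ Icc a b := fun t ht => ⟨by linarith [ht.2], by linarith [ht.1]⟩
  refine ⟨⟨h.lt, h.cont.comp (by fun_prop) hm, ?_⟩, ?_⟩
  · intro s hs t ht hst
    have := h.inj (hm s hs) (hm t ht) hst
    linarith
  · ext z
    constructor
    · rintro ⟨s, hs, rfl⟩
      exact ⟨_, hm s hs, rfl⟩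
    · rintro ⟨s, hs, rfl⟩
      exact ⟨_, hm s hs, by simp⟩

/-- localisation of a parameter of an arc inside a chart -/
lemma Arc.chart_local {γ : ℝ → X} {a b t : ℝ} (h : Arc γ a b) (ht : t ∈ Icc a b)
    {ψ : ℂ → X} (hψ : IsOpenEmbedding ψ) (hr : γ t ∈ range ψ) :
    ∃ a' b' : ℝ, ∃ β : ℝ → ℂ, Arc β a' b' ∧ a ≤ a' ∧ b' ≤ b ∧ a' ≤ t ∧ t ≤ b' ∧ (a < t → a' < t) ∧ (t < b → t < b') ∧
      ψ (β t) = γ t ∧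
      ∀ᶠ z in 𝓝 (β t), (z ∈ ψ ⁻¹' (γ '' Icc a b) ↔ z ∈ β '' Icc a' b') := by
  obtain ⟨δ, hδ, hδ'⟩ := h.near ht (hψ.isOpen_range.mem_nhds hr)
  have hlt := h.lt
  have hab : max a (t - δ) < min b (t + δ) := by
    have h1 := ht.1
    have h2 := ht.2
    simp only [max_lt_iff, lt_min_iff]
    exact ⟨⟨hlt, by linarith⟩, by linarith, by linarith⟩
  have ha : a ≤ max a (t - δ) := le_max_left _ _
  have hb : min b (t + δ) ≤ b := min_le_left _ _
  have hsub : Icc (max a (t - δ)) (min b (t + δ)) ⊆ Icc a b := Icc_subset_Icc ha hb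
  have hs := h.sub ha hab hb
  obtain ⟨β, hβ, hβ1, hβ2⟩ := hs.chart_mk hψ (fun s hs => hδ' s (hsub hs) (by
    rw [abs_le]
    have h1 := le_trans (le_max_right _ _) hs.1
    have h2 := le_trans hs.2 (min_le_right _ _)
    constructor <;> linarith))
  have htm : t ∈ Icc (max a (t - δ)) (min b (t + δ)) :=
    ⟨max_le ht.1 (by linarith), le_min ht.2 (by linarith)⟩
  refine ⟨_, _, β, hβ, ha, hb, htm.1, htm.2, fun h => max_lt h (by linarith), fun h => lt_min h (by linarith),
    hβ1 t htm, ?_⟩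
  rw [← hβ2]
  have h3 := h.local_eq hsub ht (by
    rw [mem_nhdsWithin_iff_exists_mem_nhds_inter]
    refine ⟨Icc (t - δ) (t + δ), Icc_mem_nhds (by linarith) (by linarith), ?_⟩
    rintro s ⟨hs1, hs2⟩
    exact ⟨max_le hs2.1 hs1.1, le_min hs2.2 hs1.2⟩)
  rw [← hβ1 t htm] at h3
  exact hψ.continuous.continuousAt h3

lemma Arc.endpoint (hX : Surf X) {γ : ℝ → X} {a b : ℝ} (h : Arc γ a b) {ε : X → ℂ}
    (hε : SG ε (γ '' Icc a b) (γ a)) : NJ ε (γ '' Icc a b) (γ a) := by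
  obtain ⟨ψ, hψ, hψ0⟩ := hX (γ a)
  have ha : a ∈ Icc a b := left_mem_Icc.2 h.lt.le
  obtain ⟨a', b', β, hβ, h0, -, h1, h2, h3, h4, h5, h6⟩ := h.chart_local ha hψ ⟨0, hψ0⟩
  obtain rfl : a' = a := le_antisymm h1 h0
  rw [← h5, ← NJ_chart hψ, NJ.congr_set h6]
  rw [← h5, ← SG_chart hψ, SG.congr_set h6] at hε
  obtain ⟨O, hO, hq, hO1⟩ := hε.exists_open
  exact endpoint_plane hβ hO hq _ (fun z hz => (hO1 z hz).2.continuousWithinAt)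
    (fun z hz => (hO1 z hz).1)

lemma Arc.endpoint' (hX : Surf X) {γ : ℝ → X} {a b : ℝ} (h : Arc γ a b) {ε : X → ℂ}
    (hε : SG ε (γ '' Icc a b) (γ b)) : NJ ε (γ '' Icc a b) (γ b) := by
  obtain ⟨h1, h2⟩ := h.reverse
  have h3 := h1.endpoint hX (ε := ε)
  rw [h2] at h3
  simp only [add_sub_cancel_left] at h3
  exact h3 hε

lemma Arc.two_sided (hX : Surf X) {γ : ℝ → X} {a b t : ℝ} (h : Arc γ a b) (ht : t ∈ Ioo a b)
    {ε₁ ε₂ : X → ℂ}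
    (hε₁ : SG ε₁ (γ '' Icc a b) (γ t)) (hε₂ : SG ε₂ (γ '' Icc a b) (γ t))
    (hj₁ : ¬ NJ ε₁ (γ '' Icc a b) (γ t)) (hj₂ : ¬ NJ ε₂ (γ '' Icc a b) (γ t)) :
    NJ (fun z => ε₁ z * ε₂ z) (γ '' Icc a b) (γ t) := by
  obtain ⟨ψ, hψ, hψ0⟩ := hX (γ t)
  obtain ⟨a', b', β, hβ, -, -, -, -, h3, h4, h5, h6⟩ :=
    h.chart_local (Ioo_subset_Icc_self ht) hψ ⟨0, hψ0⟩
  rw [← h5, ← NJ_chart hψ, NJ.congr_set h6] at hj₁ hj₂ ⊢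
  rw [← h5, ← SG_chart hψ, SG.congr_set h6] at hε₁ hε₂
  obtain ⟨O₁, hO₁, hq₁, hO1₁⟩ := hε₁.exists_open
  obtain ⟨O₂, hO₂, hq₂, hO1₂⟩ := hε₂.exists_open
  exact two_sided_plane hβ ⟨h3 ht.1, h4 ht.2⟩ (hO₁.inter hO₂) ⟨hq₁, hq₂⟩ _ _
    (fun z hz => (hO1₁ z ⟨hz.1.1, hz.2⟩).2.continuousWithinAt)
    (fun z hz => (hO1₁ z ⟨hz.1.1, hz.2⟩).1)
    (fun z hz => (hO1₂ z ⟨hz.1.2, hz.2⟩).2.continuousWithinAt)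
    (fun z hz => (hO1₂ z ⟨hz.1.2, hz.2⟩).1) hj₁ hj₂

/-- one step of propagation along an arc -/
lemma Arc.propagate (hX : Surf X) {γ : ℝ → X} {a b s t : ℝ} (h : Arc γ a b) (hs : s < t) (ht : t ∈ Ico a b)
    {ε : X → ℂ} (hε : SG ε (γ '' Icc a b) (γ t))
    (hn : ∀ r ∈ Ico s t, r ∈ Icc a b → NJ ε (γ '' Icc a b) (γ r)) :
    NJ ε (γ '' Icc a b) (γ t) := by
  set A := γ '' Icc a b with hA
  have hAc : IsClosed A := h.isCompact.isClosed
  have hd : Dense Aᶜ := h.dense_compl hX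
  have h2 : Arc γ t b := h.sub ht.1 ht.2 le_rfl
  have hsub : γ '' Icc t b ⊆ A := image_mono (Icc_subset_Icc ht.1 le_rfl)
  obtain ⟨O, hO, hqO, hO1⟩ := hε.exists_open
  have hloc : ∀ᶠ z in 𝓝 (γ t), z ∈ A → z ∈ γ '' (Icc a b ∩ Ici s) := by
    obtain ⟨ρ, hρ, -, hρ'⟩ := h.retract
    have : Ici s ∈ 𝓝 (ρ (γ t)) := by rw [hρ' t (Ico_subset_Icc_self ht)]; exact Ici_mem_nhds hs
    filter_upwards [hρ.continuousAt this] with z hz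
    rintro ⟨r, hr, rfl⟩
    refine ⟨r, ⟨hr, ?_⟩, rfl⟩
    have h4 : ρ (γ r) ∈ Ici s := hz
    rwa [hρ' r hr] at h4
  obtain ⟨O', hO', hO'o, hqO'⟩ := eventually_nhds_iff.1 hloc
  set ε' := extendFrom Aᶜ ε with hε'
  have key : ∀ z ∈ (O ∩ O') \ γ '' Icc t b, NJ ε A z := by
    rintro z ⟨⟨hzO, hzO'⟩, hzn⟩
    by_cases hzA : z ∈ A
    · obtain ⟨r, ⟨hr1, hr2⟩, rfl⟩ := hO' z hzO' hzA
      refine hn r ⟨hr2, ?_⟩ hr1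
      by_contra hc
      exact hzn ⟨r, ⟨not_lt.1 hc, hr1.2⟩, rfl⟩
    · refine NJ_of_SG_off hAc ?_ hzA
      rw [SG, eventually_nhdsWithin_iff]
      filter_upwards [hO.mem_nhds hzO] with y hy hyA
      exact hO1 y ⟨hy, hyA⟩
  have hval : ∀ z ∈ (O ∩ O') \ γ '' Icc t b, ∃ c, Tendsto ε (𝓝[Aᶜ] z) (𝓝 c) := by
    intro z hz
    obtain ⟨c, hc⟩ := key z hz
    exact ⟨c, tendsto_const_nhds.congr' (by filter_upwards [hc] with y hy using hy.symm)⟩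
  have hcont : ContinuousOn ε' ((O ∩ O') \ γ '' Icc t b) :=
    continuousOn_extendFrom (fun z _ => hd z) hval
  have hsq : ∀ z ∈ (O ∩ O') \ γ '' Icc t b, ε' z ^ 2 = 1 := by
    intro z hz
    obtain ⟨c, hc⟩ := hval z hz
    haveI := compl_ne_bot hd z
    have h5 : ε' z = c := extendFrom_eq (hd z) hc
    rw [h5]
    have h6 : Tendsto (fun y => ε y ^ 2) (𝓝[Aᶜ] z) (𝓝 (c ^ 2)) := hc.pow 2
    refine tendsto_nhds_unique h6 (tendsto_const_nhds.congr' ?_)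
    filter_upwards [self_mem_nhdsWithin, mem_nhdsWithin_of_mem_nhds (hO.mem_nhds hz.1.1)] with y hy hyO
    exact ((hO1 y ⟨hyO, hy⟩).1).symm
  have hopen : IsOpen ((O ∩ O') \ γ '' Icc t b) := (hO.inter hO'o).sdiff h2.isCompact.isClosed
  have h7 : SG ε' (γ '' Icc t b) (γ t) := by
    rw [SG, eventually_nhdsWithin_iff]
    filter_upwards [(hO.inter hO'o).mem_nhds ⟨hqO, hqO'⟩] with y hy hyn
    exact ⟨hsq y ⟨hy, hyn⟩, hcont.continuousAt (hopen.mem_nhds ⟨hy, hyn⟩)⟩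
  refine ((h2.endpoint hX h7).anti hsub).congr ?_
  filter_upwards [self_mem_nhdsWithin, mem_nhdsWithin_of_mem_nhds (hO.mem_nhds hqO)] with y hy hyO
  refine (extendFrom_eq (hd y) ?_).symm
  exact (hO1 y ⟨hyO, hy⟩).2.tendsto.mono_left nhdsWithin_le_nhds

lemma Arc.seg (hX : Surf X) {γ : ℝ → X} {a b s t : ℝ} (h : Arc γ a b) (hs : a ≤ s) (ht : t < b)
    {ε : X → ℂ} (hε : ∀ r ∈ Icc s t, SG ε (γ '' Icc a b) (γ r))
    (hn : NJ ε (γ '' Icc a b) (γ s)) :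
    ∀ r ∈ Icc s t, NJ ε (γ '' Icc a b) (γ r) := by
  by_contra hcon
  push Not at hcon
  let T := {r | r ∈ Icc s t ∧ ¬ NJ ε (γ '' Icc a b) (γ r)}
  have hTn : T.Nonempty := by obtain ⟨r, h1, h2⟩ := hcon; exact ⟨r, h1, h2⟩
  have hTb : BddBelow T := ⟨s, fun r hr => hr.1.1⟩
  set u := sInf T with hu
  have hsu : s ≤ u := le_csInf hTn fun r hr => hr.1.1
  have hut : u ≤ t := by obtain ⟨r, hr⟩ := hTn; exact (csInf_le hTb hr).trans hr.1.2
  have hlt : ∀ r ∈ Ico s u, NJ ε (γ '' Icc a b) (γ r) := by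
    intro r hr
    by_contra hc
    exact absurd (csInf_le hTb ⟨⟨hr.1, hr.2.le.trans hut⟩, hc⟩) (not_le.2 hr.2)
  have huN : NJ ε (γ '' Icc a b) (γ u) := by
    rcases hsu.eq_or_lt with h1 | h1
    · rwa [← h1]
    · exact h.propagate hX h1 ⟨hs.trans hsu, hut.trans_lt ht⟩ (hε u ⟨hsu, hut⟩)
        fun r hr _ => hlt r hr
  obtain ⟨δ, hδ, hδ'⟩ := h.near ⟨hs.trans hsu, hut.trans ht.le⟩ huN.eventually
  obtain ⟨r, hr, hru⟩ := exists_lt_of_csInf_lt hTn (lt_add_of_pos_right u hδ)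
  refine hr.2 (hδ' r ⟨hs.trans hr.1.1, hr.1.2.trans ht.le⟩ ?_)
  have := csInf_le hTb hr
  rw [abs_of_nonneg] <;> linarith

lemma Arc.seg' (hX : Surf X) {γ : ℝ → X} {a b s t : ℝ} (h : Arc γ a b) (hs : a < s) (ht : t ≤ b)
    {ε : X → ℂ} (hε : ∀ r ∈ Icc s t, SG ε (γ '' Icc a b) (γ r))
    (hn : NJ ε (γ '' Icc a b) (γ t)) :
    ∀ r ∈ Icc s t, NJ ε (γ '' Icc a b) (γ r) := by
  obtain ⟨h1, h2⟩ := h.reverse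
  have h3 := h1.seg hX (s := a + b - t) (t := a + b - s) (ε := ε) (by linarith) (by linarith)
  rw [h2] at h3
  intro r hr
  have := h3 (fun r hr => hε _ ⟨by linarith [hr.2], by linarith [hr.1]⟩) (by simpa using hn)
    (a + b - r) ⟨by linarith [hr.2], by linarith [hr.1]⟩
  simpa using this

/-- an arc does not separate a connected surface -/
lemma Arc.nonsep (hX : Surf X) [PreconnectedSpace X] {γ : ℝ → X} {a b : ℝ} (h : Arc γ a b)
    {ε : X → ℂ} (hε : ∀ q, SG ε (γ '' Icc a b) q) :
    ∃ c, ∀ z ∉ γ '' Icc a b, ε z = c := by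
  have hA : IsClosed (γ '' Icc a b) := h.isCompact.isClosed
  have key : ∀ q ∈ (univ : Set X), NJ ε (γ '' Icc a b) q := by
    intro q _
    by_cases hq : q ∈ γ '' Icc a b
    · obtain ⟨t, ht, rfl⟩ := hq
      rcases ht.2.eq_or_lt with h1 | h1
      · rw [h1]; exact h.endpoint' hX (hε _)
      · exact h.seg hX le_rfl h1 (fun r _ => hε _) (h.endpoint hX (hε _)) t ⟨ht.1, le_rfl⟩
    · exact NJ_of_SG_off hA (hε q) hq
  obtain ⟨c, hc⟩ := NJ_ext isPreconnected_univ isOpen_univ (h.dense_compl hX) hA key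
  exact ⟨c, fun z hz => hc z ⟨mem_univ _, hz⟩⟩

end general
end CC

namespace CC

/-- `ρ`, defined off `Z`, extends continuously near `q`. -/
def Ext {X : Type*} [TopologicalSpace X] (ρ : X → ℂ) (Z : Set X) (q : X) : Prop :=
  ∃ s : X → ℂ, (∀ᶠ z in 𝓝 q, ContinuousAt s z) ∧ ∀ᶠ z in 𝓝[Zᶜ] q, s z = ρ z

lemma Ext.eventually {X : Type*} [TopologicalSpace X] {ρ : X → ℂ} {Z : Set X} {q : X}
    (h : Ext ρ Z q) : ∀ᶠ p in 𝓝 q, Ext ρ Z p := by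
  obtain ⟨s, h1, h2⟩ := h
  filter_upwards [eventually_eventually_nhds.2 h1, eventually_nhds_nhdsWithin.2 h2] with p h3 h4
  exact ⟨s, h3, h4⟩

lemma Ext.congr_set {X : Type*} [TopologicalSpace X] {ρ : X → ℂ} {Z Z' : Set X} {q : X}
    (h : ∀ᶠ z in 𝓝 q, (z ∈ Z ↔ z ∈ Z')) : Ext ρ Z q ↔ Ext ρ Z' q := by
  unfold Ext; rw [nhdsWithin_compl_congr h]

/-- multiply by a continuous function -/
lemma Ext.mul {X : Type*} [TopologicalSpace X] {ρ ρ' g : X → ℂ} {Z : Set X} {q : X}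
    (h : Ext ρ Z q) (hg : ∀ᶠ z in 𝓝 q, ContinuousAt g z)
    (he : ∀ᶠ z in 𝓝[Zᶜ] q, ρ' z = ρ z * g z) : Ext ρ' Z q := by
  obtain ⟨s, h1, h2⟩ := h
  refine ⟨fun z => s z * g z, ?_, ?_⟩
  · filter_upwards [h1, hg] with z h3 h4 using h3.mul h4
  · filter_upwards [h2, he] with z h3 h4
    rw [h3, h4]

lemma sqrt_ball {c e : ℂ} {r : ℝ} (he : e ∉ ball c r) :
    ∃ w : ℂ → ℂ, ∀ z ∈ ball c r, ContinuousAt w z ∧ w z ≠ 0 ∧ w z ^ 2 = z - e := by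
  rcases le_or_gt r 0 with hr | hr
  · exact ⟨0, fun z hz => by simp [ball_eq_empty.2 hr] at hz⟩
  have hce : c - e ≠ 0 := fun h0 => he (by rw [← sub_eq_zero.1 h0]; exact mem_ball_self hr)
  have her : r ≤ ‖c - e‖ := by
    rw [mem_ball, dist_comm, dist_eq_norm, not_lt] at he; exact he
  have hsl : ∀ z ∈ ball c r, 1 + (z - c) / (c - e) ∈ Complex.slitPlane := by
    intro z hz
    apply Complex.mem_slitPlane_of_norm_lt_one
    rw [norm_div, div_lt_one (norm_pos_iff.2 hce)]
    rw [mem_ball, dist_eq_norm] at hz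
    linarith
  refine ⟨fun z => Complex.exp (Complex.log (c - e) / 2) *
    Complex.exp (Complex.log (1 + (z - c) / (c - e)) / 2), fun z hz => ⟨?_, ?_, ?_⟩⟩
  · have : ContinuousAt (fun z => Complex.log (1 + (z - c) / (c - e))) z :=
      ContinuousAt.clog (by fun_prop) (hsl z hz)
    fun_prop
  · exact mul_ne_zero (Complex.exp_ne_zero _) (Complex.exp_ne_zero _)
  · rw [mul_pow, exp_half, exp_half, Complex.exp_log hce,
      Complex.exp_log (Complex.slitPlane_ne_zero (hsl z hz))]
    field_simp
    ring

lemma sqrt_frac {x p q : ℂ} (hp : x ≠ p) (hq : x ≠ q) :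
    ∃ s : ℂ → ℂ, ∀ᶠ z in 𝓝 x, ContinuousAt s z ∧ s z ≠ 0 ∧ s z ^ 2 = (z - p) / (z - q) := by
  obtain ⟨w, hw⟩ := sqrt_ball (c := x) (e := p) (r := dist p x) (by simp)
  obtain ⟨v, hv⟩ := sqrt_ball (c := x) (e := q) (r := dist q x) (by simp)
  refine ⟨fun z => w z / v z, ?_⟩
  filter_upwards [ball_mem_nhds x (dist_pos.2 hp.symm), ball_mem_nhds x (dist_pos.2 hq.symm)]
    with z h1 h2
  obtain ⟨a1, a2, a3⟩ := hw z h1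
  obtain ⟨b1, b2, b3⟩ := hv z h2
  exact ⟨a1.div b1 b2, div_ne_zero a2 b2, by rw [div_pow, a3, b3]⟩

lemma NJ_of_Ext {X : Type*} [TopologicalSpace X] {ρ s : X → ℂ} {Z : Set X} {p : X}
    (hs : ∀ᶠ z in 𝓝 p, ContinuousAt s z ∧ s z ≠ 0) (hS : SG (fun z => ρ z / s z) Z p)
    (h : Ext ρ Z p) : NJ (fun z => ρ z / s z) Z p := by
  obtain ⟨r, h1, h2⟩ := h
  have hc : ContinuousAt (fun z => r z / s z) p :=
    h1.self_of_nhds.div hs.self_of_nhds.1 hs.self_of_nhds.2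
  set v := r p / s p with hv
  have h3 : ∀ᶠ z in 𝓝[Zᶜ] p, dist (ρ z / s z) v < 1 := by
    have : ∀ᶠ z in 𝓝 p, dist (r z / s z) v < 1 := hc (ball_mem_nhds _ one_pos)
    filter_upwards [this.filter_mono nhdsWithin_le_nhds, h2] with z h4 h5
    rwa [← h5]
  by_cases h1v : dist 1 v < 1
  · refine ⟨1, ?_⟩
    filter_upwards [h3, hS] with z h4 h5
    rcases sq1 h5.1 with h6 | h6
    · exact h6
    · rw [h6] at h4
      exfalso
      have h7 := dist_triangle_right (1:ℂ) (-1) v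
      have h8 : dist (1:ℂ) (-1) = 2 := by rw [dist_eq_norm]; norm_num
      linarith
  · refine ⟨-1, ?_⟩
    filter_upwards [h3, hS] with z h4 h5
    rcases sq1 h5.1 with h6 | h6
    · rw [h6] at h4; exact (h1v h4).elim
    · exact h6

lemma Ext_of_NJ {X : Type*} [TopologicalSpace X] {ρ s : X → ℂ} {Z : Set X} {p : X}
    (hs : ∀ᶠ z in 𝓝 p, ContinuousAt s z ∧ s z ≠ 0)
    (h : NJ (fun z => ρ z / s z) Z p) : Ext ρ Z p := by
  obtain ⟨c, hc⟩ := h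
  refine ⟨fun z => c * s z, ?_, ?_⟩
  · filter_upwards [hs] with z hz using continuousAt_const.mul hz.1
  · filter_upwards [hc, hs.filter_mono nhdsWithin_le_nhds] with z h1 h2
    rw [← h1]; exact div_mul_cancel₀ _ h2.2

lemma jump {β : ℝ → ℂ} {a b : ℝ} (h : Arc β a b) {ρ : ℂ → ℂ}
    (hρ : ContinuousOn ρ (β '' Icc a b)ᶜ)
    (hρ2 : ∀ z ∈ (β '' Icc a b)ᶜ, ρ z ^ 2 = (z - β a) / (z - β b)) {t : ℝ} (ht : t ∈ Ioo a b) :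
    ¬ Ext ρ (β '' Icc a b) (β t) := by
  intro hE
  set A := β '' Icc a b with hA
  have hAc : IsClosed A := h.isCompact.isClosed
  have hd : Dense Aᶜ := h.dense_compl surf_C
  have ham : a ∈ Icc a b := left_mem_Icc.2 h.lt.le
  have hbm : b ∈ Icc a b := right_mem_Icc.2 h.lt.le
  have hρc : ∀ z ∈ Aᶜ, ContinuousAt ρ z := fun z hz => hρ.continuousAt (hAc.isOpen_compl.mem_nhds hz)
  have hneb : β a ≠ β b := fun h0 => h.lt.ne (h.inj ham hbm h0)
  have step : ∀ t ∈ Ioo a b, ∀ᶠ r in 𝓝[Ioo a b] t,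
      (Ext ρ A (β t) → Ext ρ A (β r)) ∧ (Ext ρ A (β r) → Ext ρ A (β t)) := by
    intro t ht
    have htm := Ioo_subset_Icc_self ht
    obtain ⟨s, hs⟩ := sqrt_frac (x := β t) (p := β a) (q := β b)
      (fun h0 => ht.1.ne' (h.inj htm ham h0)) (fun h0 => ht.2.ne (h.inj htm hbm h0))
    have hs' := eventually_eventually_nhds.2 hs
    obtain ⟨δ, hδ, hδ'⟩ := h.near htm hs'
    have hs1 : ∀ r ∈ Icc a b, |r - t| ≤ δ → ∀ᶠ z in 𝓝 (β r), ContinuousAt s z ∧ s z ≠ 0 := by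
      intro r hr hrt
      filter_upwards [hδ' r hr hrt] with z hz using ⟨hz.1, hz.2.1⟩
    have hSG : ∀ r ∈ Icc a b, |r - t| ≤ δ → SG (fun z => ρ z / s z) A (β r) := by
      intro r hr hrt
      rw [SG, eventually_nhdsWithin_iff]
      filter_upwards [hδ' r hr hrt] with z hz hzA
      refine ⟨?_, (hρc z hzA).div hz.1 hz.2.1⟩
      rw [div_pow, hz.2.2, hρ2 z hzA, div_self]
      rw [← hz.2.2]; exact pow_ne_zero _ hz.2.1
    have hev : ∀ᶠ r in 𝓝[Ioo a b] t, r ∈ Ioo a b ∧ |r - t| ≤ δ := by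
      refine (eventually_mem_nhdsWithin).and ?_
      filter_upwards [mem_nhdsWithin_of_mem_nhds (closedBall_mem_nhds t hδ)] with r hr
      simpa [Real.dist_eq] using hr
    filter_upwards [hev] with r hr
    have h0 : |t - t| ≤ δ := by simp [hδ.le]
    have hrm := Ioo_subset_Icc_self hr.1
    have habs := abs_le.1 hr.2
    have e1 : Ext ρ A (β t) → NJ (fun z => ρ z / s z) A (β t) :=
      NJ_of_Ext (hs1 t htm h0) (hSG t htm h0)
    have e2 : Ext ρ A (β r) → NJ (fun z => ρ z / s z) A (β r) :=
      NJ_of_Ext (hs1 r hrm hr.2) (hSG r hrm hr.2)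
    rcases le_total r t with hle | hle
    · have hS : ∀ u ∈ Icc r t, SG (fun z => ρ z / s z) A (β u) := fun u hu =>
        hSG u ⟨hr.1.1.le.trans hu.1, hu.2.trans ht.2.le⟩ (by
          rw [abs_le]; constructor <;> linarith [hu.1, hu.2])
      exact ⟨fun hx => Ext_of_NJ (hs1 r hrm hr.2)
          (h.seg' surf_C hr.1.1 ht.2.le hS (e1 hx) r ⟨le_rfl, hle⟩),
        fun hx => Ext_of_NJ (hs1 t htm h0)
          (h.seg surf_C hr.1.1.le ht.2 hS (e2 hx) t ⟨hle, le_rfl⟩)⟩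
    · have hS : ∀ u ∈ Icc t r, SG (fun z => ρ z / s z) A (β u) := fun u hu =>
        hSG u ⟨ht.1.le.trans hu.1, hu.2.trans hr.1.2.le⟩ (by
          rw [abs_le]; constructor <;> linarith [hu.1, hu.2])
      exact ⟨fun hx => Ext_of_NJ (hs1 r hrm hr.2)
          (h.seg surf_C ht.1.le hr.1.2 hS (e1 hx) r ⟨hle, le_rfl⟩),
        fun hx => Ext_of_NJ (hs1 t htm h0)
          (h.seg' surf_C ht.1 hr.1.2.le hS (e2 hx) t ⟨le_rfl, hle⟩)⟩
  have hall : ∀ r ∈ Ioo a b, Ext ρ A (β r) := by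
    intro r hr
    exact isPreconnected_Ioo.induction₂' (fun t r => Ext ρ A (β t) → Ext ρ A (β r)) step
      (fun x y z _ _ _ h1 h2 h3 => h2 (h1 h3)) ht hr hE
  set ρ' := extendFrom Aᶜ ρ with hρ'
  have hT : ∀ x ∈ ({β a, β b} : Set ℂ)ᶜ, ∃ y, Tendsto ρ (𝓝[Aᶜ] x) (𝓝 y) := by
    intro x hx
    by_cases hxA : x ∈ A
    · obtain ⟨r, hr, rfl⟩ := hxA
      have hr' : r ∈ Ioo a b := by
        refine ⟨lt_of_le_of_ne hr.1 ?_, lt_of_le_of_ne hr.2 ?_⟩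
        · rintro rfl; exact hx (by simp)
        · rintro rfl; exact hx (by simp)
      obtain ⟨s, h1, h2⟩ := hall r hr'
      exact ⟨s (β r), (h1.self_of_nhds.tendsto.mono_left nhdsWithin_le_nhds).congr' h2⟩
    · exact ⟨ρ x, (hρc x hxA).tendsto.mono_left nhdsWithin_le_nhds⟩
  have hcont : ContinuousOn ρ' ({β a, β b} : Set ℂ)ᶜ := continuousOn_extendFrom (fun z _ => hd z) hT
  have hsq : ∀ x ∈ ({β a, β b} : Set ℂ)ᶜ, ρ' x ^ 2 = (x - β a) / (x - β b) := by
    intro x hx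
    obtain ⟨y, hy⟩ := hT x hx
    have := compl_ne_bot hd x
    rw [hρ', extendFrom_eq (hd x) hy]
    refine tendsto_nhds_unique (hy.pow 2) ?_
    have hxb : x - β b ≠ 0 := fun h0 => hx (by rw [sub_eq_zero.1 h0]; simp)
    have hc : ContinuousAt (fun x => (x - β a) / (x - β b)) x :=
      ContinuousAt.div (by fun_prop) (by fun_prop) hxb
    refine (hc.tendsto.mono_left nhdsWithin_le_nhds).congr' ?_
    filter_upwards [self_mem_nhdsWithin] with z hz using (hρ2 z hz).symm
  obtain ⟨w, hw⟩ := sqrt_ball (c := β a) (e := β b) (r := dist (β b) (β a)) (by simp)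
  have hdpos : 0 < dist (β b) (β a) := dist_pos.2 hneb.symm
  set R := dist (β b) (β a) / 2 with hR
  have hRp : 0 < R := by positivity
  have hsb : sphere (β a) R ⊆ ball (β a) (dist (β b) (β a)) := by
    intro z hz
    rw [mem_sphere] at hz
    rw [mem_ball, hz]; linarith
  have hsc : sphere (β a) R ⊆ ({β a, β b} : Set ℂ)ᶜ := by
    intro z hz hz'
    rw [mem_sphere] at hz
    rcases hz' with rfl | rfl
    · simp at hz; linarith
    · linarith
  apply no_sqrt_sphere (β a) R hRp (fun z => ρ' z * w z)
  · exact (hcont.mono hsc).mul fun z hz => (hw z (hsb hz)).1.continuousWithinAt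
  · intro z hz
    have h1 : z - β b ≠ 0 := by
      rw [← (hw z (hsb hz)).2.2]; exact pow_ne_zero _ (hw z (hsb hz)).2.1
    show (ρ' z * w z) ^ 2 = _
    rw [mul_pow, hsq z (hsc hz), (hw z (hsb hz)).2.2, div_mul_cancel₀ _ h1]

end CC

namespace CC

open Classical in
noncomputable def theta {X : Type*} (ψ : ℂ → X) (p : X) (z : ℂ) : ℂ :=
  if p ∈ ψ '' ball 0 2 then z - Function.invFun ψ p else 1

lemma theta_ne {X : Type*} {ψ : ℂ → X} {p : X} {z : ℂ} (h : ψ z ≠ p) : theta ψ p z ≠ 0 := by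
  unfold theta
  split_ifs with h1
  · intro h0
    apply h
    rw [sub_eq_zero.1 h0]
    obtain ⟨y, -, hy⟩ := h1
    exact Function.invFun_eq ⟨y, hy⟩
  · exact one_ne_zero

def PQ {X : Type*} (ψ : ℂ → X) (γ : ℝ → X) (u v : ℝ) : Prop :=
  ∃ ρ : ℂ → ℂ, (∀ z ∈ ball (0:ℂ) 2, ψ z ∉ γ '' Icc u v →
      ContinuousAt ρ z ∧ ρ z ≠ 0 ∧ ρ z ^ 2 = theta ψ (γ u) z / theta ψ (γ v) z) ∧
    ∀ t ∈ Ioo u v, ∀ z ∈ ball (0:ℂ) 2, ψ z = γ t → ¬ Ext ρ (ψ ⁻¹' (γ '' Icc u v)) z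

section
variable {X : Type*} [TopologicalSpace X] [T2Space X] [NormalSpace X]

lemma Ext_mul_left {ρ₁ ρ₂ : ℂ → ℂ} {Z₁ Z₂ : Set ℂ} {z : ℂ} (hz : ∀ᶠ y in 𝓝 z, y ∉ Z₂)
    (h2 : ∀ᶠ y in 𝓝 z, ContinuousAt ρ₂ y ∧ ρ₂ y ≠ 0)
    (h : Ext (fun y => ρ₁ y * ρ₂ y) (Z₁ ∪ Z₂) z) : Ext ρ₁ Z₁ z := by
  have hs : ∀ᶠ y in 𝓝 z, (y ∈ Z₁ ∪ Z₂ ↔ y ∈ Z₁) := by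
    filter_upwards [hz] with y hy
    simp [hy]
  rw [Ext.congr_set hs] at h
  refine h.mul (g := fun y => (ρ₂ y)⁻¹) ?_ ?_
  · filter_upwards [h2] with y hy using hy.1.inv₀ hy.2
  · filter_upwards [h2.filter_mono nhdsWithin_le_nhds] with y hy
    rw [mul_inv_cancel_right₀ hy.2]

lemma PQ.concat {ψ : ℂ → X} (hψ : IsOpenEmbedding ψ) {γ : ℝ → X} {a b c : ℝ} (h : Arc γ a c)
    (hab : a < b) (hbc : b < c) (h1 : PQ ψ γ a b) (h2 : PQ ψ γ b c) : PQ ψ γ a c := by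
  obtain ⟨ρ₁, hρ₁, hj₁⟩ := h1
  obtain ⟨ρ₂, hρ₂, hj₂⟩ := h2
  have hun : γ '' Icc a c = γ '' Icc a b ∪ γ '' Icc b c := by
    rw [← image_union, Icc_union_Icc_eq_Icc hab.le hbc.le]
  have hc1 : IsClosed (γ '' Icc a b) := (h.sub le_rfl hab hbc.le).isCompact.isClosed
  have hc2 : IsClosed (γ '' Icc b c) := (h.sub hab.le hbc le_rfl).isCompact.isClosed
  have hb2 : γ b ∈ γ '' Icc b c := ⟨b, left_mem_Icc.2 hbc.le, rfl⟩
  have hn1 : ∀ z ∈ ball (0:ℂ) 2, ψ z ∉ γ '' Icc a b → (∀ᶠ y in 𝓝 z, y ∉ ψ ⁻¹' (γ '' Icc a b)) ∧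
      ∀ᶠ y in 𝓝 z, ContinuousAt ρ₁ y ∧ ρ₁ y ≠ 0 := by
    intro z hz hzn
    have h1 : ∀ᶠ y in 𝓝 z, ψ y ∉ γ '' Icc a b :=
      hψ.continuous.continuousAt (hc1.isOpen_compl.mem_nhds hzn)
    refine ⟨h1, ?_⟩
    filter_upwards [h1, isOpen_ball.mem_nhds hz] with y hy hyb
    exact ⟨(hρ₁ y hyb hy).1, (hρ₁ y hyb hy).2.1⟩
  have hn2 : ∀ z ∈ ball (0:ℂ) 2, ψ z ∉ γ '' Icc b c → (∀ᶠ y in 𝓝 z, y ∉ ψ ⁻¹' (γ '' Icc b c)) ∧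
      ∀ᶠ y in 𝓝 z, ContinuousAt ρ₂ y ∧ ρ₂ y ≠ 0 := by
    intro z hz hzn
    have h1 : ∀ᶠ y in 𝓝 z, ψ y ∉ γ '' Icc b c :=
      hψ.continuous.continuousAt (hc2.isOpen_compl.mem_nhds hzn)
    refine ⟨h1, ?_⟩
    filter_upwards [h1, isOpen_ball.mem_nhds hz] with y hy hyb
    exact ⟨(hρ₂ y hyb hy).1, (hρ₂ y hyb hy).2.1⟩
  have hleft : ∀ t ∈ Ioo a b, ∀ z ∈ ball (0:ℂ) 2, ψ z = γ t →
      ¬ Ext (fun y => ρ₁ y * ρ₂ y) (ψ ⁻¹' (γ '' Icc a c)) z := by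
    intro t ht z hz hzt hE
    rw [hun, preimage_union] at hE
    have hzn : ψ z ∉ γ '' Icc b c := by
      rintro ⟨r, hr, hrt⟩
      have := h.inj ⟨hab.le.trans hr.1, hr.2⟩ ⟨ht.1.le, ht.2.le.trans hbc.le⟩ (hrt.trans hzt)
      linarith [ht.2, hr.1]
    exact hj₁ t ht z hz hzt (Ext_mul_left (hn2 z hz hzn).1 (hn2 z hz hzn).2 hE)
  have hright : ∀ t ∈ Ioo b c, ∀ z ∈ ball (0:ℂ) 2, ψ z = γ t →
      ¬ Ext (fun y => ρ₁ y * ρ₂ y) (ψ ⁻¹' (γ '' Icc a c)) z := by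
    intro t ht z hz hzt hE
    rw [hun, union_comm, preimage_union] at hE
    have hzn : ψ z ∉ γ '' Icc a b := by
      rintro ⟨r, hr, hrt⟩
      have := h.inj ⟨hr.1, hr.2.trans hbc.le⟩ ⟨hab.le.trans ht.1.le, ht.2.le⟩ (hrt.trans hzt)
      linarith [ht.1, hr.2]
    refine hj₂ t ht z hz hzt (Ext_mul_left (hn1 z hz hzn).1 (hn1 z hz hzn).2 ?_)
    simpa only [mul_comm] using hE
  refine ⟨fun y => ρ₁ y * ρ₂ y, ?_, ?_⟩
  · intro z hz hzn
    rw [hun] at hzn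
    obtain ⟨a1, a2, a3⟩ := hρ₁ z hz (fun h => hzn (Or.inl h))
    obtain ⟨b1, b2, b3⟩ := hρ₂ z hz (fun h => hzn (Or.inr h))
    refine ⟨a1.mul b1, mul_ne_zero a2 b2, ?_⟩
    have hne : theta ψ (γ b) z ≠ 0 := theta_ne fun h => hzn (Or.inr (h ▸ hb2))
    show (ρ₁ z * ρ₂ z) ^ 2 = _
    rw [mul_pow, a3, b3, div_mul_div_cancel₀ hne]
  · intro t ht z hz hzt hE
    rcases lt_trichotomy t b with htb | rfl | htb
    · exact hleft t ⟨ht.1, htb⟩ z hz hzt hE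
    · have h3 := hE.eventually.and (isOpen_ball.mem_nhds hz)
      have h4 := hψ.isOpenMap.image_mem_nhds h3
      rw [hzt] at h4
      obtain ⟨δ, hδ, hδ'⟩ := h.near (Ioo_subset_Icc_self ht) h4
      obtain ⟨r, hr1, hr2⟩ : ∃ r, max a (t - δ) < r ∧ r < t :=
        exists_between (max_lt hab (by linarith))
      rw [max_lt_iff] at hr1
      obtain ⟨y, ⟨hy1, hy2⟩, hy3⟩ := hδ' r ⟨hr1.1.le, hr2.le.trans hbc.le⟩ (by
        rw [abs_le]; constructor <;> linarith [hr1.2])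
      exact hleft r ⟨hr1.1, hr2⟩ y hy2 hy3 hy1
    · exact hright t ⟨htb, ht.2⟩ z hz hzt hE

lemma sqrt_theta {ψ : ℂ → X} (hψ : IsOpenEmbedding ψ) (e : ℂ) :
    ∃ w : ℂ → ℂ, ∀ z ∈ ball (0:ℂ) 2, ContinuousAt w z ∧ w z ≠ 0 ∧
      (z ≠ e → theta ψ (ψ e) z = (z - e) / w z ^ 2) := by
  by_cases he : e ∈ ball (0:ℂ) 2
  · refine ⟨fun _ => 1, fun z _ => ⟨continuousAt_const, one_ne_zero, fun _ => ?_⟩⟩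
    rw [theta, if_pos ⟨e, he, rfl⟩, Function.leftInverse_invFun hψ.injective e]; simp
  · obtain ⟨w, hw⟩ := sqrt_ball he
    refine ⟨w, fun z hz => ⟨(hw z hz).1, (hw z hz).2.1, fun hne => ?_⟩⟩
    rw [theta, if_neg, (hw z hz).2.2, div_self (sub_ne_zero.2 hne)]
    rintro ⟨y, hy, hye⟩
    exact he (hψ.injective hye ▸ hy)

lemma PQ.locally {ψ : ℂ → X} (hψ : IsOpenEmbedding ψ) {γ : ℝ → X} {a b t : ℝ} (h : Arc γ a b)
    (ht : t ∈ Icc a b) : ∃ δ > 0, ∀ u ∈ Icc a b, ∀ v ∈ Icc a b, u < v → |u - t| ≤ δ → |v - t| ≤ δ →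
      PQ ψ γ u v := by
  by_cases hr : γ t ∈ range ψ
  · obtain ⟨δ, hδ, hδ'⟩ := h.near ht (hψ.isOpen_range.mem_nhds hr)
    refine ⟨δ, hδ, fun u hu v hv huv hut hvt => ?_⟩
    have hs : Arc γ u v := h.sub hu.1 huv hv.2
    rw [abs_le] at hut hvt
    obtain ⟨β, hβ, hβ1, hβ2⟩ := hs.chart_mk hψ fun s hs => hδ' s
      ⟨hu.1.trans hs.1, hs.2.trans hv.2⟩ (by rw [abs_le]; constructor <;> linarith [hs.1, hs.2])
    obtain ⟨ρ, hρ, hρ0, hρ2⟩ := arc_sqrt hβ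
    have hum : u ∈ Icc u v := left_mem_Icc.2 huv.le
    have hvm : v ∈ Icc u v := right_mem_Icc.2 huv.le
    obtain ⟨w₁, hw₁⟩ := sqrt_theta hψ (β u)
    obtain ⟨w₂, hw₂⟩ := sqrt_theta hψ (β v)
    rw [hβ1 u hum] at hw₁
    rw [hβ1 v hvm] at hw₂
    have hopen : IsOpen (β '' Icc u v)ᶜ := hβ.isCompact.isClosed.isOpen_compl
    refine ⟨fun z => ρ z * (w₂ z / w₁ z), ?_, ?_⟩
    · intro z hz hzn
      have hz' : z ∈ (β '' Icc u v)ᶜ := by rw [← hβ2]; exact hzn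
      obtain ⟨a1, a2, a3⟩ := hw₁ z hz
      obtain ⟨b1, b2, b3⟩ := hw₂ z hz
      refine ⟨(hρ.continuousAt (hopen.mem_nhds hz')).mul (b1.div a1 a2),
        mul_ne_zero (hρ0 z) (div_ne_zero b2 a2), ?_⟩
      have hzu : z ≠ β u := fun h0 => hz' (h0 ▸ ⟨u, hum, rfl⟩)
      have hzv : z ≠ β v := fun h0 => hz' (h0 ▸ ⟨v, hvm, rfl⟩)
      show (ρ z * (w₂ z / w₁ z)) ^ 2 = _
      rw [a3 hzu, b3 hzv, mul_pow, hρ2 z hz', div_pow]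
      have := sub_ne_zero.2 hzv
      field_simp
    · intro r hr z hz hzr hE
      have hzb : z = β r := hψ.injective (by rw [hzr, hβ1 r (Ioo_subset_Icc_self hr)])
      subst hzb
      rw [hβ2] at hE
      refine jump hβ hρ hρ2 hr (hE.mul (g := fun z => w₁ z / w₂ z) ?_ ?_)
      · filter_upwards [isOpen_ball.mem_nhds hz] with y hy
        exact (hw₁ y hy).1.div (hw₂ y hy).1 (hw₂ y hy).2.1
      · filter_upwards [mem_nhdsWithin_of_mem_nhds (isOpen_ball.mem_nhds hz)] with y hy
        have c1 := (hw₁ y hy).2.1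
        have c2 := (hw₂ y hy).2.1
        field_simp
  · have hcl : IsClosed (ψ '' closedBall 0 2) :=
      ((isCompact_closedBall (0:ℂ) 2).image hψ.continuous).isClosed
    obtain ⟨δ, hδ, hδ'⟩ := h.near ht (hcl.isOpen_compl.mem_nhds
      (fun h0 => hr (image_subset_range _ _ h0)))
    have hsub : ψ '' ball 0 2 ⊆ ψ '' closedBall 0 2 := image_mono ball_subset_closedBall
    refine ⟨δ, hδ, fun u hu v hv huv hut hvt => ⟨fun _ => 1, ?_, ?_⟩⟩
    · intro z hz _
      refine ⟨continuousAt_const, one_ne_zero, ?_⟩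
      rw [theta, if_neg fun h0 => hδ' u hu hut (hsub h0), theta,
        if_neg fun h0 => hδ' v hv hvt (hsub h0)]
      simp
    · intro r hr z hz hzr
      rw [abs_le] at hut hvt
      exact (hδ' r ⟨hu.1.trans hr.1.le, hr.2.le.trans hv.2⟩
        (by rw [abs_le]; constructor <;> linarith [hr.1, hr.2]) (hsub ⟨z, hz, hzr⟩)).elim

lemma PQ.all {ψ : ℂ → X} (hψ : IsOpenEmbedding ψ) {γ : ℝ → X} {a b : ℝ} (h : Arc γ a b) :
    PQ ψ γ a b := by
  have hl : ∀ t : Icc a b, ∃ δ > 0, ∀ u ∈ Icc a b, ∀ v ∈ Icc a b, u < v → |u - t| ≤ δ →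
      |v - t| ≤ δ → PQ ψ γ u v := fun t => PQ.locally hψ h t.2
  choose δ hδ hδ' using hl
  obtain ⟨t, ht0, htm, ⟨m, hm⟩, ht⟩ := exists_monotone_Icc_subset_open_cover_Icc h.lt.le
    (c := fun i : Icc a b => ball i (δ i)) (fun i => isOpen_ball)
    (fun x _ => mem_iUnion.2 ⟨x, mem_ball_self (hδ x)⟩)
  have key : ∀ n, (t n : ℝ) = a ∨ PQ ψ γ a (t n) := by
    intro n
    induction n with
    | zero => left; exact ht0
    | succ n ih =>
      rcases (htm (Nat.le_succ n)).eq_or_lt with h1 | h1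
      · rw [Nat.succ_eq_add_one] at h1
        rwa [← h1]
      · right
        obtain ⟨i, hi⟩ := ht n
        have hd : ∀ x : Icc a b, x ∈ ball i (δ i) → |(x:ℝ) - i| ≤ δ i := by
          intro x hx
          have : dist (x:ℝ) i < δ i := hx
          rw [Real.dist_eq] at this
          exact this.le
        have h1' : (t n : ℝ) < t (n+1) := h1
        have h2 : PQ ψ γ (t n) (t (n+1)) := hδ' i _ (t n).2 _ (t (n+1)).2 h1'
          (hd _ (hi (left_mem_Icc.2 h1.le))) (hd _ (hi (right_mem_Icc.2 h1.le)))
        rcases ih with h3 | h3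
        · rwa [h3] at h2
        · rcases (t n).2.1.eq_or_lt with h4 | h4
          · rwa [← h4] at h2
          · exact PQ.concat hψ (h.sub le_rfl (h4.trans h1') (t (n+1)).2.2) h4 h1' h3 h2
  rcases key m with h1 | h1
  · rw [hm m le_rfl] at h1; exact (h.lt.ne' h1).elim
  · rwa [hm m le_rfl] at h1

/-- square roots in a chart -/
lemma chart_sqrt {ψ : ℂ → X} (hψ : IsOpenEmbedding ψ) (d₁ d₃ : X) :
    ∃ G : X → ℂ, ∀ (γ : ℝ → X) (a b : ℝ), Arc γ a b → γ a = d₁ → γ b = d₃ → ∃ R : X → ℂ,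
      (∀ y ∈ ψ '' ball 0 2, y ∉ γ '' Icc a b → ContinuousAt R y ∧ R y ≠ 0 ∧ R y ^ 2 = G y) ∧
      ∀ t ∈ Ioo a b, γ t ∈ ψ '' ball 0 2 → ¬ Ext R (γ '' Icc a b) (γ t) := by
  refine ⟨fun y => theta ψ d₁ (Function.invFun ψ y) / theta ψ d₃ (Function.invFun ψ y), ?_⟩
  intro γ a b h ha hb
  obtain ⟨ρ, hρ, hj⟩ := PQ.all hψ h
  have hinv : ∀ z, Function.invFun ψ (ψ z) = z := Function.leftInverse_invFun hψ.injective
  have hcomp : (fun y => ρ (Function.invFun ψ y)) ∘ ψ = ρ := by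
    funext z; simp [hinv]
  refine ⟨fun y => ρ (Function.invFun ψ y), ?_, ?_⟩
  · rintro _ ⟨z, hz, rfl⟩ hzn
    obtain ⟨h1, h2, h3⟩ := hρ z hz hzn
    rw [← hψ.continuousAt_iff, hcomp]
    simp only [hinv]
    refine ⟨h1, h2, ?_⟩
    rw [h3, ha, hb]
  · rintro t ht ⟨z, hz, hzt⟩ ⟨s, hs1, hs2⟩
    refine hj t ht z hz hzt ⟨s ∘ ψ, ?_, ?_⟩
    · rw [← hzt] at hs1
      filter_upwards [hψ.continuous.continuousAt.eventually hs1] with y hy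
      exact hψ.continuousAt_iff.2 hy
    · rw [← hzt, ← nhdsWithin_open_embedding hψ, eventually_map] at hs2
      filter_upwards [hs2] with y hy
      simpa [hinv] using hy

end
end CC

namespace CC

lemma preconn_punct (R : ℝ) (hR : 0 < R) : IsPreconnected (ball (0:ℂ) R \ {0}) := by
  have h1 : IsPreconnected {z : ℂ | z.re < Real.log R} :=
    (convex_halfSpace_re_lt (Real.log R)).isPreconnected
  have h2 := h1.image Complex.exp Complex.continuous_exp.continuousOn
  convert h2 using 1
  ext z
  simp only [mem_ofPred_eq, mem_image, Set.mem_sdiff, mem_ball_zero_iff, mem_singleton_iff]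
  constructor
  · rintro ⟨hz, h0⟩
    refine ⟨Complex.log z, ?_, Complex.exp_log h0⟩
    rw [Complex.log_re]
    exact Real.log_lt_log (norm_pos_iff.2 h0) hz
  · rintro ⟨w, hw, rfl⟩
    refine ⟨?_, Complex.exp_ne_zero _⟩
    rw [Complex.norm_exp]
    exact (Real.lt_log_iff_exp_lt hR).1 hw

structure Cradle {X I : Type*} [TopologicalSpace X] (γ : I → ℝ → X) (d₁ d₃ : X) : Prop where
  arc : ∀ i, Arc (γ i) 0 1
  e0 : ∀ i, γ i 0 = d₁
  e1 : ∀ i, γ i 1 = d₃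
  dis : ∀ i j, i ≠ j → ∀ t ∈ Ioo (0:ℝ) 1, γ i t ∉ γ j '' Icc 0 1

structure Root {X I : Type*} [TopologicalSpace X] (γ : I → ℝ → X) (V : Set X) (G : X → ℂ)
    (R : I → X → ℂ) : Prop where
  opn : IsOpen V
  root : ∀ i, ∀ y ∈ V, y ∉ γ i '' Icc 0 1 → ContinuousAt (R i) y ∧ R i y ≠ 0 ∧ R i y ^ 2 = G y
  jmp : ∀ i, ∀ t ∈ Ioo (0:ℝ) 1, γ i t ∈ V → ¬ Ext (R i) (γ i '' Icc 0 1) (γ i t)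

section
variable {X I : Type*} [TopologicalSpace X] [T2Space X] [NormalSpace X]
  {γ : I → ℝ → X} {d₁ d₃ : X} {V V' B : Set X} {G G' : X → ℂ} {R R' : I → X → ℂ}

lemma Cradle.closed (hC : Cradle γ d₁ d₃) (i : I) : IsClosed (γ i '' Icc 0 1) :=
  (hC.arc i).isCompact.isClosed

lemma Cradle.pts (hC : Cradle γ d₁ d₃) {i : I} {z : X} (hz : z ∈ γ i '' Icc 0 1) :
    z = d₁ ∨ z = d₃ ∨ ∃ t ∈ Ioo (0:ℝ) 1, γ i t = z := by
  obtain ⟨t, ht, rfl⟩ := hz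
  rcases ht.1.eq_or_lt with h | h
  · left; rw [← h, hC.e0]
  rcases ht.2.eq_or_lt with h' | h'
  · right; left; rw [h', hC.e1]
  · exact Or.inr (Or.inr ⟨t, ⟨h, h'⟩, rfl⟩)

lemma Cradle.near (hC : Cradle γ d₁ d₃) {i j : I} (hij : i ≠ j) {t : ℝ} (ht : t ∈ Ioo (0:ℝ) 1) :
    ∀ᶠ z in 𝓝 (γ i t), (z ∈ γ i '' Icc 0 1 ∪ γ j '' Icc 0 1 ↔ z ∈ γ i '' Icc 0 1) := by
  filter_upwards [(hC.closed j).isOpen_compl.mem_nhds (hC.dis i j hij t ht)] with z hz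
  have : z ∉ γ j '' Icc 0 1 := hz
  simp only [mem_union, this, or_false]

lemma Cradle.dense2 (hX : Surf X) (hC : Cradle γ d₁ d₃) (i j : I) :
    Dense (γ i '' Icc 0 1 ∪ γ j '' Icc 0 1)ᶜ := by
  rw [compl_union]
  exact ((hC.arc i).dense_compl hX).inter_of_isOpen_left ((hC.arc j).dense_compl hX)
    (hC.closed i).isOpen_compl

lemma Cradle.dense3 (hX : Surf X) (hC : Cradle γ d₁ d₃) (i j k : I) :
    Dense (γ i '' Icc 0 1 ∪ γ j '' Icc 0 1 ∪ γ k '' Icc 0 1)ᶜ := by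
  rw [compl_union]
  exact (hC.dense2 hX i j).inter_of_isOpen_left ((hC.arc k).dense_compl hX)
    ((hC.closed i).union (hC.closed j)).isOpen_compl

lemma Root.sign (hR : Root γ V G R) {i j : I} {y : X} (hy : y ∈ V) (hi : y ∉ γ i '' Icc 0 1)
    (hj : y ∉ γ j '' Icc 0 1) :
    (R i y / R j y) ^ 2 = 1 ∧ ContinuousAt (fun z => R i z / R j z) y := by
  obtain ⟨a1, a2, a3⟩ := hR.root i y hy hi
  obtain ⟨b1, b2, b3⟩ := hR.root j y hy hj
  refine ⟨?_, a1.div b1 b2⟩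
  rw [div_pow, a3, b3, div_self]
  rw [← a3]; exact pow_ne_zero _ a2

lemma Root.SG (hR : Root γ V G R) (i j : I) {q : X} (hq : q ∈ V) :
    SG (fun z => R i z / R j z) (γ i '' Icc 0 1 ∪ γ j '' Icc 0 1) q := by
  rw [CC.SG, eventually_nhdsWithin_iff]
  filter_upwards [hR.opn.mem_nhds hq] with z hz hzn
  exact hR.sign hz (fun h => hzn (Or.inl h)) (fun h => hzn (Or.inr h))

lemma Root.jump (hC : Cradle γ d₁ d₃) (hR : Root γ V G R) {i j : I} (hij : i ≠ j) {t : ℝ}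
    (ht : t ∈ Ioo (0:ℝ) 1) (hV : γ i t ∈ V) :
    ¬ NJ (fun z => R i z / R j z) (γ i '' Icc 0 1 ∪ γ j '' Icc 0 1) (γ i t) := by
  intro h
  rw [NJ.congr_set (hC.near hij ht)] at h
  refine hR.jmp i t ht hV (Ext_of_NJ ?_ h)
  filter_upwards [hR.opn.mem_nhds hV, (hC.closed j).isOpen_compl.mem_nhds (hC.dis i j hij t ht)]
    with z h1 h2
  exact ⟨(hR.root j z h1 h2).1, (hR.root j z h1 h2).2.1⟩

lemma Root.jump' (hC : Cradle γ d₁ d₃) (hR : Root γ V G R) {i j : I} (hij : i ≠ j) {t : ℝ}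
    (ht : t ∈ Ioo (0:ℝ) 1) (hV : γ j t ∈ V) :
    ¬ NJ (fun z => R i z / R j z) (γ i '' Icc 0 1 ∪ γ j '' Icc 0 1) (γ j t) := by
  rintro ⟨c, hc⟩
  apply hR.jump hC hij.symm ht hV
  rw [union_comm]
  refine ⟨c⁻¹, ?_⟩
  filter_upwards [hc] with z hz
  rw [← hz, inv_div]

lemma const_pair (hX : Surf X) (hC : Cradle γ d₁ d₃) (hd : d₁ ≠ d₃) (hR : Root γ V G R)
    (hR' : Root γ V' G' R') {i j : I} (hij : i ≠ j) (hBo : IsOpen B) (hBc : IsPreconnected B)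
    (hBn : B.Nonempty) (hBV : B ⊆ V) (hBV' : B ⊆ V') :
    ∃ c : ℂ, c ^ 2 = 1 ∧ ∀ z ∈ B \ (γ i '' Icc 0 1 ∪ γ j '' Icc 0 1),
      R i z / R j z = c * (R' i z / R' j z) := by
  set Z := γ i '' Icc 0 1 ∪ γ j '' Icc 0 1 with hZ
  have hZc : IsClosed Z := (hC.closed i).union (hC.closed j)
  have hZd : Dense Zᶜ := hC.dense2 hX i j
  have hSG1 : ∀ q ∈ B, SG (fun z => R i z / R j z) Z q := fun q hq => hR.SG i j (hBV hq)
  have hSG2 : ∀ q ∈ B, SG (fun z => R' i z / R' j z) Z q := fun q hq => hR'.SG i j (hBV' hq)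
  let η : X → ℂ := fun z => (R i z / R j z) * (R' i z / R' j z)
  have h1 : ∀ q ∈ B, q ≠ d₁ → q ≠ d₃ → NJ η Z q := by
    intro q hq hq1 hq3
    by_cases hqi : q ∈ γ i '' Icc 0 1
    · rcases hC.pts hqi with h | h | ⟨t, ht, rfl⟩
      · exact (hq1 h).elim
      · exact (hq3 h).elim
      · have hn := hC.near hij ht
        have j1 := hR.jump hC hij ht (hBV hq)
        have j2 := hR'.jump hC hij ht (hBV' hq)
        have s1 := hSG1 _ hq
        have s2 := hSG2 _ hq
        rw [NJ.congr_set hn] at j1 j2 ⊢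
        rw [SG.congr_set hn] at s1 s2
        exact (hC.arc i).two_sided hX ht s1 s2 j1 j2
    by_cases hqj : q ∈ γ j '' Icc 0 1
    · rcases hC.pts hqj with h | h | ⟨t, ht, rfl⟩
      · exact (hq1 h).elim
      · exact (hq3 h).elim
      · have hn := hC.near hij.symm ht
        rw [union_comm] at hn
        have j1 := hR.jump' hC hij ht (hBV hq)
        have j2 := hR'.jump' hC hij ht (hBV' hq)
        have s1 := hSG1 _ hq
        have s2 := hSG2 _ hq
        rw [NJ.congr_set hn] at j1 j2 ⊢
        rw [SG.congr_set hn] at s1 s2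
        exact (hC.arc j).two_sided hX ht s1 s2 j1 j2
    · refine NJ_of_SG_off hZc ?_ (fun h => h.elim hqi hqj)
      filter_upwards [hSG1 q hq, hSG2 q hq] with z h3 h4
      exact ⟨by simp only [η]; rw [mul_pow, h3.1, h4.1, one_mul], h3.2.mul h4.2⟩
  have hend : ∀ q ∈ B, q ∈ Z → ∀ q', q' ≠ q → (∀ p ∈ B, p ≠ q → p ≠ q' → NJ η Z p) → NJ η Z q := by
    intro q hq hqZ q' hqq' hp
    obtain ⟨φ, hφ, hφ0⟩ := hX q
    have hnh : φ ⁻¹' (B ∩ {q'}ᶜ) ∈ 𝓝 (0:ℂ) := by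
      apply hφ.continuous.continuousAt
      rw [hφ0]
      exact (hBo.inter isOpen_compl_singleton).mem_nhds ⟨hq, hqq'.symm⟩
    obtain ⟨r, hr, hrb⟩ := Metric.mem_nhds_iff.1 hnh
    have hPo : IsOpen (φ '' (ball 0 r \ {0})) :=
      hφ.isOpenMap _ (isOpen_ball.sdiff isClosed_singleton)
    have hPc : IsPreconnected (φ '' (ball 0 r \ {0})) :=
      (preconn_punct r hr).image _ hφ.continuous.continuousOn
    obtain ⟨c, hc⟩ := NJ_ext hPc hPo hZd hZc (η := η) (by
      rintro _ ⟨z, ⟨hz1, hz2⟩, rfl⟩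
      have h3 := hrb hz1
      refine hp _ h3.1 (fun h4 => hz2 ?_) h3.2
      rw [← hφ0] at h4
      exact hφ.injective h4)
    refine ⟨c, ?_⟩
    rw [eventually_nhdsWithin_iff]
    have h5 := hφ.isOpenMap.image_mem_nhds (ball_mem_nhds (0:ℂ) hr)
    rw [hφ0] at h5
    filter_upwards [h5] with y hy hyZ
    obtain ⟨z, hz, rfl⟩ := hy
    refine hc _ ⟨⟨z, ⟨hz, ?_⟩, rfl⟩, hyZ⟩
    rintro rfl
    rw [hφ0] at hyZ
    exact hyZ hqZ
  have hall : ∀ q ∈ B, NJ η Z q := by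
    intro q hq
    by_cases hq1 : q = d₁
    · subst hq1
      refine hend q hq (Or.inl ⟨0, by simp, hC.e0 i⟩) d₃ hd.symm fun p hp h2 h3 => h1 p hp h2 h3
    by_cases hq3 : q = d₃
    · subst hq3
      refine hend q hq (Or.inl ⟨1, by simp, hC.e1 i⟩) d₁ hd fun p hp h2 h3 => h1 p hp h3 h2
    exact h1 q hq hq1 hq3
  obtain ⟨c, hc⟩ := NJ_ext hBc hBo hZd hZc hall
  have hs : ∀ z ∈ B \ Z, (R i z / R j z) ^ 2 = 1 ∧ (R' i z / R' j z) ^ 2 = 1 := fun z hz =>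
    ⟨(hR.sign (hBV hz.1) (fun h => hz.2 (Or.inl h)) (fun h => hz.2 (Or.inr h))).1,
     (hR'.sign (hBV' hz.1) (fun h => hz.2 (Or.inl h)) (fun h => hz.2 (Or.inr h))).1⟩
  refine ⟨c, ?_, ?_⟩
  · obtain ⟨z, hzB, hzZ⟩ := hZd.inter_open_nonempty B hBo hBn
    rw [← hc z ⟨hzB, hzZ⟩]
    simp only [η]
    rw [mul_pow, (hs z ⟨hzB, hzZ⟩).1, (hs z ⟨hzB, hzZ⟩).2, one_mul]
  · intro z hz
    rw [← hc z hz]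
    simp only [η]
    rw [mul_assoc, ← pow_two, (hs z hz).2, mul_one]

end
end CC

namespace CC

lemma sign_ne_neg {e : ℂ} (h : e ^ 2 = 1) : e ≠ -e := by
  rcases sq1 h with rfl | rfl <;> norm_num

section
variable {X I : Type*} [TopologicalSpace X] [T2Space X] [NormalSpace X]
  {γ : I → ℝ → X} {d₁ d₃ : X}

lemma const_on {W P : Set X} {f : X → ℂ} (hP : IsPreconnected P)
    (hf : ∀ z ∉ W, f z ^ 2 = 1 ∧ ContinuousAt f z) (hPW : ∀ z ∈ P, z ∉ W) :
    ∃ e : ℂ, e ^ 2 = 1 ∧ ∀ z ∈ P, f z = e := by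
  rcases sign_const hP f (fun _ => 1) (fun z hz => (hf z (hPW z hz)).2.continuousWithinAt)
    continuousOn_const (fun z hz => by simpa using (hf z (hPW z hz)).1) (fun _ _ => one_ne_zero)
    with h | h
  · exact ⟨1, by norm_num, h⟩
  · exact ⟨-1, by norm_num, h⟩

lemma loc_const {W : Set X} {f : X → ℂ} (hW : IsClosed W)
    (hf : ∀ z ∉ W, f z ^ 2 = 1 ∧ ContinuousAt f z) {z : X} (hz : z ∉ W) :
    ∀ᶠ y in 𝓝 z, f y = f z :=
  sign_lc hW.isOpen_compl (fun y hy => (hf y hy).2.continuousWithinAt) (fun y hy => (hf y hy).1) hz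

lemma Cradle.join (hC : Cradle γ d₁ d₃) {C : Set X} (hCc : IsPreconnected C) {i : I} {t : ℝ}
    (ht : t ∈ Ioo (0:ℝ) 1) (hcl : γ i t ∈ closure C) : IsPreconnected (C ∪ γ i '' Ioo 0 1) := by
  have h1 : IsPreconnected (insert (γ i t) C) :=
    hCc.subset_closure (subset_insert _ _) (insert_subset hcl subset_closure)
  have h2 : IsPreconnected (γ i '' Ioo 0 1) :=
    isPreconnected_Ioo.image _ ((hC.arc i).cont.mono Ioo_subset_Icc_self)
  have h3 := IsPreconnected.union (γ i t) (mem_insert _ _) (mem_image_of_mem (γ i) ht) h1 h2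
  convert h3 using 1
  rw [insert_union, insert_eq_of_mem]
  exact Or.inr ⟨t, ht, rfl⟩

lemma final_contra [PreconnectedSpace X] (hX : Surf X) (hC : Cradle γ d₁ d₃) {i j k : I}
    (hij : i ≠ j) (hjk : j ≠ k) (hik : i ≠ k) {f g h : X → ℂ}
    (hf : ∀ z ∉ γ i '' Icc 0 1 ∪ γ j '' Icc 0 1, f z ^ 2 = 1 ∧ ContinuousAt f z)
    (hg : ∀ z ∉ γ j '' Icc 0 1 ∪ γ k '' Icc 0 1, g z ^ 2 = 1 ∧ ContinuousAt g z)
    (hh : ∀ z ∉ γ i '' Icc 0 1 ∪ γ k '' Icc 0 1, h z ^ 2 = 1 ∧ ContinuousAt h z)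
    (hfg : ∀ z, z ∉ γ i '' Icc 0 1 → z ∉ γ j '' Icc 0 1 → z ∉ γ k '' Icc 0 1 → f z * g z = h z)
    (hj : ∀ t ∈ Ioo (0:ℝ) 1, ¬ NJ f (γ i '' Icc 0 1 ∪ γ j '' Icc 0 1) (γ j t))
    {C : Set X} (hCc : IsPreconnected C) (hCi : ∀ z ∈ C, z ∉ γ i '' Icc 0 1)
    (hCj : ∀ z ∈ C, z ∉ γ j '' Icc 0 1) (hCk : ∀ z ∈ C, z ∉ γ k '' Icc 0 1)
    (hti : ∃ t ∈ Ioo (0:ℝ) 1, γ i t ∈ closure C)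
    (htj : ∃ t ∈ Ioo (0:ℝ) 1, γ j t ∈ closure C)
    (htk : ∃ t ∈ Ioo (0:ℝ) 1, γ k t ∈ closure C) : False := by
  classical
  obtain ⟨ti, hti, hci⟩ := hti
  obtain ⟨tj, htj, hcj⟩ := htj
  obtain ⟨tk, htk, hck⟩ := htk
  have cij := (hC.closed i).union (hC.closed j)
  have cjk := (hC.closed j).union (hC.closed k)
  have cik := (hC.closed i).union (hC.closed k)
  obtain ⟨eg, heg, hge⟩ := const_on (hC.join hCc hti hci) hg (by
    rintro z (hz | ⟨t, ht, rfl⟩)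
    · exact fun h0 => h0.elim (hCj z hz) (hCk z hz)
    · exact fun h0 => h0.elim (hC.dis i j hij t ht) (hC.dis i k hik t ht))
  obtain ⟨ef, hef, hfe⟩ := const_on (hC.join hCc htk hck) hf (by
    rintro z (hz | ⟨t, ht, rfl⟩)
    · exact fun h0 => h0.elim (hCi z hz) (hCj z hz)
    · exact fun h0 => h0.elim (hC.dis k i hik.symm t ht) (hC.dis k j hjk.symm t ht))
  let E : X → ℂ := fun z => if (z ∉ γ i '' Icc 0 1 ∧ z ∉ γ j '' Icc 0 1 ∧ z ∉ γ k '' Icc 0 1) ∧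
    f z = -ef ∧ g z = -eg then -1 else 1
  have hE1 : ∀ z, E z ^ 2 = 1 := by
    intro z; simp only [E]; split_ifs <;> norm_num
  have hEc : ∀ z ∉ γ j '' Icc 0 1, ContinuousAt E z := by
    intro z hz
    suffices hs : ∀ᶠ y in 𝓝 z, E y = E z from
      continuousAt_const.congr (by filter_upwards [hs] with y hy using hy.symm)
    by_cases hzi : z ∈ γ i '' Icc 0 1
    · rcases hC.pts hzi with rfl | rfl | ⟨t, ht, rfl⟩
      · exact (hz ⟨0, by simp, hC.e0 j⟩).elim
      · exact (hz ⟨1, by simp, hC.e1 j⟩).elim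
      · have hgz := hge (γ i t) (Or.inr ⟨t, ht, rfl⟩)
        have h1 := loc_const cjk hg (z := γ i t) (fun h0 => h0.elim hz (hC.dis i k hik t ht))
        have h2 : ∀ y, g y = eg → E y = 1 := by
          intro y hy
          simp only [E]
          rw [if_neg]
          rintro ⟨-, -, h3⟩
          exact sign_ne_neg heg (hy.symm.trans h3)
        filter_upwards [h1] with y hy
        rw [h2 y (hy.trans hgz), h2 _ hgz]
    by_cases hzk : z ∈ γ k '' Icc 0 1
    · rcases hC.pts hzk with rfl | rfl | ⟨t, ht, rfl⟩
      · exact (hz ⟨0, by simp, hC.e0 j⟩).elim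
      · exact (hz ⟨1, by simp, hC.e1 j⟩).elim
      · have hfz := hfe (γ k t) (Or.inr ⟨t, ht, rfl⟩)
        have h1 := loc_const cij hf (z := γ k t)
          (fun h0 => h0.elim (hC.dis k i hik.symm t ht) hz)
        have h2 : ∀ y, f y = ef → E y = 1 := by
          intro y hy
          simp only [E]
          rw [if_neg]
          rintro ⟨-, h3, -⟩
          exact sign_ne_neg hef (hy.symm.trans h3)
        filter_upwards [h1] with y hy
        rw [h2 y (hy.trans hfz), h2 _ hfz]
    · filter_upwards [loc_const cij hf (z := z) (fun h0 => h0.elim hzi hz),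
        loc_const cjk hg (z := z) (fun h0 => h0.elim hz hzk),
        (hC.closed i).isOpen_compl.mem_nhds hzi, (hC.closed j).isOpen_compl.mem_nhds hz,
        (hC.closed k).isOpen_compl.mem_nhds hzk] with y y1 y2 y3 y4 y5
      have y3' : y ∉ γ i '' Icc 0 1 := y3
      have y4' : y ∉ γ j '' Icc 0 1 := y4
      have y5' : y ∉ γ k '' Icc 0 1 := y5
      simp only [E, y1, y2, y3', y4', y5', hz, hzi, hzk]
  obtain ⟨c, hc⟩ := (hC.arc j).nonsep hX (ε := E) (fun q => by
    rw [SG, eventually_nhdsWithin_iff]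
    exact Eventually.of_forall fun z hz => ⟨hE1 z, hEc z hz⟩)
  have hEC : ∀ z ∈ C, E z = 1 := by
    intro z hz
    simp only [E]
    rw [if_neg]
    rintro ⟨-, h3, -⟩
    exact sign_ne_neg hef ((hfe z (Or.inl hz)).symm.trans h3)
  have hqj : γ j tj ∉ γ i '' Icc 0 1 ∪ γ k '' Icc 0 1 := fun h0 =>
    h0.elim (hC.dis j i hij.symm tj htj) (hC.dis j k hjk tj htj)
  have hloc := loc_const cik hh hqj
  obtain ⟨z0, hz0C, hz0⟩ : ∃ z ∈ C, h z = h (γ j tj) := by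
    obtain ⟨z, hz1, hz2⟩ := mem_closure_iff_nhds.1 hcj _ hloc
    exact ⟨z, hz2, hz1⟩
  have hc1 : c = 1 := by rw [← hc z0 (hCj z0 hz0C), hEC z0 hz0C]
  have hhv : h (γ j tj) = ef * eg := by
    rw [← hz0, ← hfg z0 (hCi z0 hz0C) (hCj z0 hz0C) (hCk z0 hz0C), hfe z0 (Or.inl hz0C),
      hge z0 (Or.inl hz0C)]
  apply hj tj htj
  refine ⟨ef, ?_⟩
  rw [eventually_nhdsWithin_iff]
  filter_upwards [hloc, (hC.closed k).isOpen_compl.mem_nhds (hC.dis j k hjk tj htj)] with y y1 y2 y3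
  have yi : y ∉ γ i '' Icc 0 1 := fun h0 => y3 (Or.inl h0)
  have yj : y ∉ γ j '' Icc 0 1 := fun h0 => y3 (Or.inr h0)
  have yk : y ∉ γ k '' Icc 0 1 := y2
  have hprod : f y * g y = ef * eg := by rw [hfg y yi yj yk, y1, hhv]
  have hf2 := (hf y y3).1
  rcases (sq_eq_sq_iff_eq_or_eq_neg.1 (hf2.trans hef.symm)) with h5 | h5
  · exact h5
  · exfalso
    have hef0 : ef ≠ 0 := by rintro rfl; norm_num at hef
    have h6 : g y = -eg := by
      rw [h5] at hprod
      have : ef * (g y + eg) = 0 := by linear_combination -hprod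
      rcases mul_eq_zero.1 this with h7 | h7
      · exact (hef0 h7).elim
      · exact eq_neg_of_add_eq_zero_left h7
    have h8 := hc y yj
    simp only [E] at h8
    rw [if_pos ⟨⟨yi, yj, yk⟩, h5, h6⟩, hc1] at h8
    norm_num at h8

/-- data depending only on the surface -/
structure Cov (X : Type*) [TopologicalSpace X] (ι D : Type) (V V' : ι → Set X) (α β : D → ι)
    (B : D → Set X) : Prop where
  closed : ∀ a, IsClosed (V a)
  cover : ∀ x, ∃ a, x ∈ V a
  sub : ∀ a, V a ⊆ V' a
  opn : ∀ d, IsOpen (B d)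
  conn : ∀ d, IsPreconnected (B d)
  ne : ∀ d, (B d).Nonempty
  sub1 : ∀ d, B d ⊆ V' (α d)
  sub2 : ∀ d, B d ⊆ V' (β d)
  cov : ∀ a b x, x ∈ V a → x ∈ V b → ∃ d, α d = a ∧ β d = b ∧ x ∈ B d

lemma Cov.glue {ι D : Type} [Finite ι] [Finite D] {V V' : ι → Set X} {α β : D → ι}
    {B : D → Set X} (hV : Cov X ι D V V' α β B) {ch : X → ι} (hch : ∀ x, x ∈ V (ch x))
    (hC : Cradle γ d₁ d₃)
    {G : ι → X → ℂ} {R : ι → I → X → ℂ} (hR : ∀ a, Root γ (V' a) (G a) (R a)) {p q : I} (hpq : p ≠ q)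
    (hT : ∀ d, ∀ z ∈ B d \ (γ p '' Icc 0 1 ∪ γ q '' Icc 0 1),
      R (α d) p z / R (α d) q z = R (β d) p z / R (β d) q z) :
    (∀ z ∉ γ p '' Icc 0 1 ∪ γ q '' Icc 0 1, (R (ch z) p z / R (ch z) q z) ^ 2 = 1 ∧
      ContinuousAt (fun z => R (ch z) p z / R (ch z) q z) z) ∧
    ∀ t ∈ Ioo (0:ℝ) 1, ¬ NJ (fun z => R (ch z) p z / R (ch z) q z)
      (γ p '' Icc 0 1 ∪ γ q '' Icc 0 1) (γ q t) := by
  set Z := γ p '' Icc 0 1 ∪ γ q '' Icc 0 1 with hZ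
  have hZc : IsClosed Z := (hC.closed p).union (hC.closed q)
  have key : ∀ x, ∀ᶠ z in 𝓝 x, z ∉ Z →
      R (ch z) p z / R (ch z) q z = R (ch x) p z / R (ch x) q z := by
    intro x
    have h1 : ∀ᶠ z in 𝓝 x, ∀ a, x ∉ V a → z ∉ V a := by
      rw [eventually_all]
      intro a
      by_cases hx : x ∈ V a
      · exact Eventually.of_forall fun z h => (h hx).elim
      · filter_upwards [(hV.closed a).isOpen_compl.mem_nhds hx] with z hz _ using hz
    have h2 : ∀ᶠ z in 𝓝 x, ∀ d, x ∈ B d → z ∈ B d := by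
      rw [eventually_all]
      intro d
      by_cases hx : x ∈ B d
      · filter_upwards [(hV.opn d).mem_nhds hx] with z hz _ using hz
      · exact Eventually.of_forall fun z h => (hx h).elim
    filter_upwards [h1, h2] with z hz1 hz2 hzZ
    have h3 : x ∈ V (ch z) := by
      by_contra h0
      exact hz1 _ h0 (hch z)
    obtain ⟨d, hd1, hd2, hd3⟩ := hV.cov _ _ x h3 (hch x)
    have := hT d z ⟨hz2 d hd3, hzZ⟩
    rwa [hd1, hd2] at this
  constructor
  · intro z hz
    obtain ⟨h1, h2⟩ := (hR (ch z)).sign (hV.sub _ (hch z)) (fun h => hz (Or.inl h))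
      (fun h => hz (Or.inr h))
    refine ⟨h1, h2.congr ?_⟩
    filter_upwards [key z, hZc.isOpen_compl.mem_nhds hz] with y hy1 hy2 using (hy1 hy2).symm
  · intro t ht hn
    refine (hR (ch (γ q t))).jump' hC hpq ht (hV.sub _ (hch _)) (hn.congr ?_)
    rw [eventually_nhdsWithin_iff]
    filter_upwards [key (γ q t)] with y hy1 hy2 using (hy1 hy2).symm

lemma exists_small (hX : Surf X) {W : Set X} (hW : IsOpen W) {x : X} (hx : x ∈ W) :
    ∃ B, IsOpen B ∧ IsPreconnected B ∧ x ∈ B ∧ B ⊆ W := by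
  obtain ⟨φ, hφ, hφ0⟩ := hX x
  have h1 : φ ⁻¹' W ∈ 𝓝 (0:ℂ) :=
    hφ.continuous.continuousAt (by rw [hφ0]; exact hW.mem_nhds hx)
  obtain ⟨r, hr, hrb⟩ := Metric.mem_nhds_iff.1 h1
  exact ⟨φ '' ball 0 r, hφ.isOpenMap _ isOpen_ball,
    (convex_ball (0:ℂ) r).isPreconnected.image _ hφ.continuous.continuousOn,
    ⟨0, mem_ball_self hr, hφ0⟩, image_subset_iff.2 hrb⟩

lemma exists_cov [CompactSpace X] (hX : Surf X) :
    ∃ (n m : ℕ) (ψ : Fin n → ℂ → X) (V : Fin n → Set X)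
      (α β : Fin m → Fin n) (B : Fin m → Set X), (∀ a, IsOpenEmbedding (ψ a)) ∧
      Cov X (Fin n) (Fin m) V (fun a => ψ a '' ball 0 2) α β B := by
  classical
  choose Ψ hΨ hΨ0 using hX
  obtain ⟨s, hs⟩ := isCompact_univ.elim_nhds_subcover (fun x : X => Ψ x '' ball 0 1) (fun x _ => by
    have := (hΨ x).isOpenMap.image_mem_nhds (ball_mem_nhds (0:ℂ) one_pos)
    rwa [hΨ0] at this)
  have hcomp : ∀ x, IsCompact (Ψ x '' closedBall 0 1) := fun x =>
    (isCompact_closedBall (0:ℂ) 1).image (hΨ x).continuous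
  have hopen : ∀ x, IsOpen (Ψ x '' ball 0 2) := fun x => (hΨ x).isOpenMap _ isOpen_ball
  have hsub : ∀ x, Ψ x '' closedBall 0 1 ⊆ Ψ x '' ball 0 2 := fun x =>
    image_mono (closedBall_subset_ball (by norm_num))
  have hpair : ∀ x y, ∃ F : Finset (Set X), (∀ B ∈ F, IsOpen B ∧ IsPreconnected B ∧ B.Nonempty ∧
      B ⊆ Ψ x '' ball 0 2 ∧ B ⊆ Ψ y '' ball 0 2) ∧
      ∀ z, z ∈ Ψ x '' closedBall 0 1 → z ∈ Ψ y '' closedBall 0 1 → ∃ B ∈ F, z ∈ B := by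
    intro x y
    have hsm : ∀ z : X, ∃ B, z ∈ Ψ x '' ball 0 2 ∩ Ψ y '' ball 0 2 →
        IsOpen B ∧ IsPreconnected B ∧ z ∈ B ∧ B ⊆ Ψ x '' ball 0 2 ∩ Ψ y '' ball 0 2 := by
      intro z
      by_cases hz : z ∈ Ψ x '' ball 0 2 ∩ Ψ y '' ball 0 2
      · obtain ⟨B, hB⟩ := exists_small (fun x => ⟨Ψ x, hΨ x, hΨ0 x⟩)
          ((hopen x).inter (hopen y)) hz
        exact ⟨B, fun _ => hB⟩
      · exact ⟨∅, fun h => (hz h).elim⟩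
    choose b hb using hsm
    have hK : IsCompact (Ψ x '' closedBall 0 1 ∩ Ψ y '' closedBall 0 1) :=
      (hcomp x).inter (hcomp y)
    have hKs : Ψ x '' closedBall 0 1 ∩ Ψ y '' closedBall 0 1 ⊆ Ψ x '' ball 0 2 ∩ Ψ y '' ball 0 2 :=
      inter_subset_inter (hsub x) (hsub y)
    obtain ⟨t, ht1, ht2⟩ := hK.elim_nhds_subcover b (fun z hz =>
      (hb z (hKs hz)).1.mem_nhds (hb z (hKs hz)).2.2.1)
    refine ⟨t.image b, ?_, ?_⟩
    · intro B hB
      obtain ⟨z, hz, rfl⟩ := Finset.mem_image.1 hB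
      obtain ⟨c1, c2, c3, c4⟩ := hb z (hKs (ht1 z hz))
      exact ⟨c1, c2, ⟨z, c3⟩, c4.trans inter_subset_left, c4.trans inter_subset_right⟩
    · intro z hz1 hz2
      obtain ⟨w, hw, hzw⟩ := mem_iUnion₂.1 (ht2 ⟨hz1, hz2⟩)
      exact ⟨b w, Finset.mem_image_of_mem _ hw, hzw⟩
  choose F hF1 hF2 using hpair
  let D := Σ p : s × s, F p.1 p.2
  let es : s ≃ Fin (Fintype.card s) := Fintype.equivFin s
  let eD : D ≃ Fin (Fintype.card D) := Fintype.equivFin D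
  refine ⟨Fintype.card s, Fintype.card D, fun a => Ψ (es.symm a), fun a => Ψ (es.symm a) '' closedBall 0 1,
    fun d => es (eD.symm d).1.1, fun d => es (eD.symm d).1.2, fun d => (eD.symm d).2,
    fun a => hΨ _, ?_⟩
  have hD : ∀ d : D, _ := fun d => hF1 _ _ _ d.2.2
  refine ⟨fun a => (hcomp _).isClosed, ?_, fun a => hsub _, fun d => (hD _).1, fun d => (hD _).2.1,
    fun d => (hD _).2.2.1, fun d => ?_, fun d => ?_, ?_⟩
  · intro x
    obtain ⟨y, hy, hxy⟩ := mem_iUnion₂.1 (hs.2 (mem_univ x))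
    refine ⟨es ⟨y, hy⟩, ?_⟩
    simp only [Equiv.symm_apply_apply]
    exact image_mono ball_subset_closedBall hxy
  · simp only [Equiv.symm_apply_apply]
    exact (hD (eD.symm d)).2.2.2.1
  · simp only [Equiv.symm_apply_apply]
    exact (hD (eD.symm d)).2.2.2.2
  · intro a b x hxa hxb
    obtain ⟨B, hB, hxB⟩ := hF2 _ _ x hxa hxb
    have hgen : ∀ d d' : D, d = d' → x ∈ (d'.2 : Set X) → x ∈ (d.2 : Set X) := by
      rintro d _ rfl h
      exact h
    refine ⟨eD ⟨(es.symm a, es.symm b), ⟨B, hB⟩⟩, ?_, ?_, ?_⟩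
    · simp only [Equiv.symm_apply_apply, Equiv.apply_symm_apply]
    · simp only [Equiv.symm_apply_apply, Equiv.apply_symm_apply]
    · exact hgen _ _ (Equiv.symm_apply_apply eD _) hxB

end
end CC

namespace CC

lemma surf_of {S : Type*} [TopologicalSpace S] (hS : LocallyEuclidean2 S) : Surf S := by
  intro x
  obtain ⟨U, hU, hx, ⟨e⟩⟩ := hS x
  let L : EuclideanSpace ℝ (Fin 2) ≃ₜ ℂ := Complex.orthonormalBasisOneI.repr.symm.toHomeomorph
  let T : ℂ ≃ₜ U := ((Homeomorph.addRight (L (e ⟨x, hx⟩))).trans L.symm).trans e.symm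
  refine ⟨fun z => (T z : S), hU.isOpenEmbedding_subtypeVal.comp T.isOpenEmbedding, ?_⟩
  simp [T]

lemma arc_of {S : Type*} [TopologicalSpace S] {A : Set S} {a b : S} (h : IsArcFrom A a b) :
    ∃ γ : ℝ → S, Arc γ 0 1 ∧ γ 0 = a ∧ γ 1 = b ∧ γ '' Icc 0 1 = A := by
  obtain ⟨f, hf, hi, rfl, h0, h1⟩ := h
  have hv : ∀ t (ht : t ∈ Icc (0:ℝ) 1), IccExtend zero_le_one f t = f ⟨t, ht⟩ :=
    fun t ht => IccExtend_of_mem _ _ ht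
  refine ⟨IccExtend zero_le_one f, ⟨zero_lt_one, hf.Icc_extend'.continuousOn, ?_⟩, ?_, ?_, ?_⟩
  · intro s hs t ht hst
    rw [hv s hs, hv t ht] at hst
    exact congrArg Subtype.val (hi hst)
  · rw [hv 0 (by simp)]; exact h0
  · rw [hv 1 (by simp)]; exact h1
  · ext z
    constructor
    · rintro ⟨t, ht, rfl⟩
      rw [hv t ht]; exact mem_range_self _
    · rintro ⟨t, rfl⟩
      exact ⟨t, t.2, hv t t.2⟩

lemma cradle_of {S I : Type*} [TopologicalSpace S] {A : I → Set S} {d₁ d₃ : S}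
    (h : IsCatsCradle d₁ d₃ A) :
    ∃ γ : I → ℝ → S, Cradle γ d₁ d₃ ∧ ∀ i, γ i '' Icc 0 1 = A i := by
  choose γ h1 h2 h3 h4 using fun i => arc_of (h.1 i)
  refine ⟨γ, ⟨h1, h2, h3, ?_⟩, h4⟩
  intro i j hij t ht hm
  have hti : t ∈ Icc (0:ℝ) 1 := Ioo_subset_Icc_self ht
  have hn : γ i t ∉ ({d₁, d₃} : Set S) := by
    rintro (h0 | h0)
    · exact ht.1.ne' ((h1 i).inj hti (by simp) (h0.trans (h2 i).symm))
    · exact ht.2.ne ((h1 i).inj hti (by simp) (Eq.trans h0 (h3 i).symm))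
  have : (A i \ {d₁, d₃}) ∩ (A j \ {d₁, d₃}) = ∅ := h.2 hij
  rw [← h4 i, ← h4 j] at this
  exact (eq_empty_iff_forall_notMem.1 this) (γ i t) ⟨⟨⟨t, hti, rfl⟩, hn⟩, ⟨hm, hn⟩⟩

lemma pigeon (m : ℕ) (col : Fin (2 * 2 ^ m + 1) → Fin m → Bool) :
    ∃ i j k, i ≠ j ∧ j ≠ k ∧ i ≠ k ∧ col i = col j ∧ col i = col k := by
  classical
  obtain ⟨y, hy⟩ := Fintype.exists_lt_card_fiber_of_mul_lt_card (f := col) (n := 2) (by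
    simp [mul_comm])
  obtain ⟨i, j, k, hi, hj, hk, h1, h2, h3⟩ := Finset.two_lt_card_iff.1 hy
  simp only [Finset.mem_filter, Finset.mem_univ, true_and] at hi hj hk
  exact ⟨i, j, k, h1, h3, h2, hi.trans hj.symm, hi.trans hk.symm⟩

end CC

/-- For every closed surface `S` there is an `N` so that, for any cat's cradle of
`N` arcs between two points through a closed disk `D₂`, no component of the
complement of the arcs in `D₂` has closure meeting every arc. -/
theorem catsCradle_no_component_meeting_all
    {S : Type*} [MetricSpace S] [CompactSpace S] [ConnectedSpace S] [Nonempty S]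
    (hS : LocallyEuclidean2 S) :
    ∃ N : ℕ, ∀ (d₁ d₃ : S) (D₂ : Set S), IsClosedDisk D₂ →
      ∀ A : Fin N → Set S, IsCatsCradleThrough d₁ d₃ D₂ A →
        ∀ x ∈ D₂ \ ⋃ i, A i,
          ¬ ∀ i, (closure (connectedComponentIn (D₂ \ ⋃ j, A j) x) ∩ A i).Nonempty := by
  classical
  have hX : CC.Surf S := CC.surf_of hS
  obtain ⟨n, m, ψ, V, α, β, B, hψ, hV⟩ := CC.exists_cov hX
  refine ⟨2 * 2 ^ m + 1 + 1, ?_⟩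
  intro d₁ d₃ D₂ hD A hA x hx hall
  obtain ⟨⟨hcr, hD13, -⟩⟩ : Nonempty (_ ∧ _ ∧ _) := ⟨hA⟩
  obtain ⟨γ, hC, hγA⟩ := CC.cradle_of hcr
  have hd : d₁ ≠ d₃ := by
    intro h
    have h0 := (hC.arc 0).inj (show (0:ℝ) ∈ Icc (0:ℝ) 1 by simp) (show (1:ℝ) ∈ Icc (0:ℝ) 1 by simp)
      ((hC.e0 0).trans (h.trans (hC.e1 0).symm))
    norm_num at h0
  choose G hG using fun a => CC.chart_sqrt (hψ a) d₁ d₃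
  choose R hR1 hR2 using fun a i => hG a (γ i) 0 1 (hC.arc i) (hC.e0 i) (hC.e1 i)
  have hR : ∀ a, CC.Root γ (ψ a '' ball 0 2) (G a) (R a) := fun a =>
    ⟨(hψ a).isOpenMap _ isOpen_ball, fun i y hy hy' => hR1 a i y hy hy', fun i => hR2 a i⟩
  have hpair : ∀ d i j, i ≠ j → ∃ c : ℂ, c ^ 2 = 1 ∧
      ∀ z ∈ B d \ (γ i '' Icc 0 1 ∪ γ j '' Icc 0 1),
        R (α d) i z / R (α d) j z = c * (R (β d) i z / R (β d) j z) := fun d i j hij =>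
    CC.const_pair hX hC hd (hR (α d)) (hR (β d)) hij (hV.opn d) (hV.conn d) (hV.ne d)
      (hV.sub1 d) (hV.sub2 d)
  choose c hc1 hc2 using fun d (j : Fin (2 * 2 ^ m + 1)) =>
    hpair d 0 j.succ (Fin.succ_ne_zero j).symm
  obtain ⟨i', j', k', hij', hjk', hik', hcij, hcik⟩ :=
    CC.pigeon m (fun j d => decide (c d j = 1))
  have hceq : ∀ p q, (fun d => decide (c d p = 1)) = (fun d => decide (c d q = 1)) →
      ∀ d, c d p = c d q := by
    intro p q h d
    have h1 := congrFun h d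
    simp only [decide_eq_decide] at h1
    rcases CC.sq1 (hc1 d p) with hp | hp <;> rcases CC.sq1 (hc1 d q) with hq | hq <;>
      rw [hp, hq] at h1 ⊢ <;> norm_num at h1
  have hT : ∀ p q, p ≠ q → (∀ d, c d p = c d q) → ∀ d,
      ∀ z ∈ B d \ (γ p.succ '' Icc 0 1 ∪ γ q.succ '' Icc 0 1),
      R (α d) p.succ z / R (α d) q.succ z = R (β d) p.succ z / R (β d) q.succ z := by
    intro p q hpq hcc d
    obtain ⟨e, he1, he2⟩ := hpair d p.succ q.succ (fun h => hpq (Fin.succ_injective _ h))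
    obtain ⟨w, hw1, hw2⟩ := (hC.dense3 hX 0 p.succ q.succ).inter_open_nonempty _ (hV.opn d) (hV.ne d)
    have w0 : w ∉ γ 0 '' Icc 0 1 := fun h => hw2 (Or.inl (Or.inl h))
    have wp : w ∉ γ p.succ '' Icc 0 1 := fun h => hw2 (Or.inl (Or.inr h))
    have wq : w ∉ γ q.succ '' Icc 0 1 := fun h => hw2 (Or.inr h)
    have e1 := he2 w ⟨hw1, fun h => h.elim wp wq⟩
    have e2 := hc2 d p w ⟨hw1, fun h => h.elim w0 wp⟩
    have e3 := hc2 d q w ⟨hw1, fun h => h.elim w0 wq⟩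
    have wa := hV.sub1 d hw1
    have wb := hV.sub2 d hw1
    have a0 := ((hR (α d)).root 0 w wa w0).2.1
    have ap := ((hR (α d)).root p.succ w wa wp).2.1
    have aq := ((hR (α d)).root q.succ w wa wq).2.1
    have b0 := ((hR (β d)).root 0 w wb w0).2.1
    have bp := ((hR (β d)).root p.succ w wb wp).2.1
    have bq := ((hR (β d)).root q.succ w wb wq).2.1
    have hcn : c d q ≠ 0 := by
      intro h
      have := hc1 d q
      rw [h] at this
      norm_num at this
    have e4 : R (α d) p.succ w / R (α d) q.succ w = R (β d) p.succ w / R (β d) q.succ w := by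
      have f1 : R (α d) p.succ w / R (α d) q.succ w
          = (R (α d) 0 w / R (α d) q.succ w) / (R (α d) 0 w / R (α d) p.succ w) := by
        field_simp
      rw [f1, e2, e3, hcc d]
      field_simp
    have e5 : e = 1 := by
      rw [e4] at e1
      have h0 : R (β d) p.succ w / R (β d) q.succ w ≠ 0 := div_ne_zero bp bq
      exact (mul_right_cancel₀ h0 (by rw [one_mul]; exact e1)).symm
    intro z hz
    rw [he2 z hz, e5, one_mul]
  choose ch hch using hV.cover
  have cij := hceq _ _ hcij
  have cik := hceq _ _ hcik
  have cjk : ∀ d, c d j' = c d k' := fun d => (cij d).symm.trans (cik d)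
  have nij : i'.succ ≠ j'.succ := fun h => hij' (Fin.succ_injective _ h)
  have njk : j'.succ ≠ k'.succ := fun h => hjk' (Fin.succ_injective _ h)
  have nik : i'.succ ≠ k'.succ := fun h => hik' (Fin.succ_injective _ h)
  obtain ⟨gf, gfj⟩ := hV.glue hch hC hR nij (hT _ _ hij' cij)
  obtain ⟨gg, -⟩ := hV.glue hch hC hR njk (hT _ _ hjk' cjk)
  obtain ⟨gh, -⟩ := hV.glue hch hC hR nik (hT _ _ hik' cik)
  set C := connectedComponentIn (D₂ \ ⋃ j, A j) x with hCdef
  have hCs : C ⊆ D₂ \ ⋃ j, A j := connectedComponentIn_subset _ _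
  have hDc : IsClosed D₂ := by
    obtain ⟨e⟩ := hD
    haveI : CompactSpace (closedBall (0 : EuclideanSpace ℝ (Fin 2)) 1) :=
      isCompact_iff_compactSpace.1 (isCompact_closedBall _ _)
    haveI : CompactSpace D₂ := e.symm.compactSpace
    exact (isCompact_iff_compactSpace.2 this).isClosed
  have hclD : closure C ⊆ D₂ := closure_minimal (hCs.trans sdiff_subset) hDc
  have hout : ∀ p, ∀ z ∈ C, z ∉ γ p '' Icc 0 1 := by
    intro p z hz h
    rw [hγA] at h
    exact (hCs hz).2 (mem_iUnion.2 ⟨p, h⟩)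
  have htt : ∀ p, ∃ t ∈ Ioo (0:ℝ) 1, γ p t ∈ closure C := by
    intro p
    obtain ⟨z, hz1, hz2⟩ := hall p
    rw [← hγA] at hz2
    rcases hC.pts hz2 with rfl | rfl | ⟨t, ht, rfl⟩
    · exact ((eq_empty_iff_forall_notMem.1 hD13) z ⟨hclD hz1, by simp⟩).elim
    · exact ((eq_empty_iff_forall_notMem.1 hD13) z ⟨hclD hz1, by simp⟩).elim
    · exact ⟨t, ht, hz1⟩
  refine CC.final_contra hX hC nij njk nik gf gg gh ?_ gfj isPreconnected_connectedComponentIn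
    (hout _) (hout _) (hout _) (htt _) (htt _) (htt _)
  intro z _ hzj _
  have := ((hR (ch z)).root j'.succ z (hV.sub _ (hch z)) hzj).2.1
  exact div_mul_div_cancel₀ this
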